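/- Let k ≥ 1 be an integer, let γ be a drawing of a graph G, and let D₁,…,D_m be pairwise distinct cycles of G, each crossing-free in γ, such that γ(D_{j+1}) is contained in the closed disk bounded by γ(D_j) for j = 1,…,m−1, and such that there is a set X ⊆ V(G) with 2 ≤ |X| ≤ 12k − 1 and V(D_i)∩V(D_j) = X for all distinct i,j. If m ≥ 24k², then γ has a 2-nest of size k. -/

import Mathlib

open Set Bornology

noncomputable section

namespace CrossingPaper

/-- Points of the plane. -/
abbrev Plane : Type := ℝ × ℝ

/-- A drawing of a (simple) graph `G` in the plane: each vertex is mapped to a point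
(injectively), and each edge `e = uv` is mapped to an arc with ends `vmap u`, `vmap v`
whose interior `emap e` avoids all vertex images; any two distinct edges intersect in
finitely many points. -/
structure Drawing {V : Type} (G : SimpleGraph V) where
  vmap : V → Plane
  emap : Sym2 V → Set Plane
  vmap_inj : Function.Injective vmap
  arc : ∀ e ∈ G.edgeSet, ∀ u v : V, e = s(u, v) →
    ∃ f : ℝ → Plane, ContinuousOn f (Icc 0 1) ∧ InjOn f (Icc 0 1) ∧
      f 0 = vmap u ∧ f 1 = vmap v ∧ emap e = f '' Ioo 0 1
  avoid : ∀ e ∈ G.edgeSet, ∀ v : V, vmap v ∉ emap e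
  finite_inter : ∀ e ∈ G.edgeSet, ∀ e' ∈ G.edgeSet, e ≠ e' → (emap e ∩ emap e').Finite

variable {V : Type} {G : SimpleGraph V}

/-- The set of crossings of a drawing: points lying on (the interiors of) two distinct
edges. -/
def Drawing.crossings (γ : Drawing G) : Set Plane :=
  {p | ∃ e ∈ G.edgeSet, ∃ e' ∈ G.edgeSet, e ≠ e' ∧ p ∈ γ.emap e ∧ p ∈ γ.emap e'}

/-- The crossing number of a graph: the minimum number of crossings over all drawings. -/
def crossingNumber (G : SimpleGraph V) : ℕ :=
  sInf {n | ∃ γ : Drawing G, γ.crossings.Finite ∧ γ.crossings.ncard = n}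

/-- `G` is `k`-crossing-critical: `cr(G) ≥ k` and `cr(G - e) < k` for every edge `e`. -/
def CrossingCritical (G : SimpleGraph V) (k : ℕ) : Prop :=
  k ≤ crossingNumber G ∧
    ∀ e ∈ G.edgeSet, crossingNumber (G.deleteEdges {e}) < k

/-- The image of a subgraph under a drawing. -/
def Drawing.image (γ : Drawing G) (H : G.Subgraph) : Set Plane :=
  γ.vmap '' H.verts ∪ ⋃ e ∈ H.edgeSet, γ.emap e

/-- The image of a whole drawing. -/
def Drawing.totalImage (γ : Drawing G) : Set Plane :=
  range γ.vmap ∪ ⋃ e ∈ G.edgeSet, γ.emap e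

/-- The union of all bounded complementary components of a set in the plane: for a
Jordan curve this is the open disk bounded by the curve. -/
def boundedSide (s : Set Plane) : Set Plane :=
  {p | p ∉ s ∧ IsBounded (connectedComponentIn sᶜ p)}

/-- For a Jordan curve, the closed disk bounded by the curve. -/
def closedRegion (s : Set Plane) : Set Plane :=
  s ∪ boundedSide s

/-- A subgraph is a cycle: connected, finite, and every vertex has exactly two
neighbours. -/
def IsCycleSubgraph (H : G.Subgraph) : Prop :=
  H.Connected ∧ H.verts.Finite ∧ ∀ v ∈ H.verts, (H.neighborSet v).ncard = 2

/-- A subgraph is crossing-free in a drawing if none of its edges is crossed by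
another edge of `G`. -/
def Drawing.CrossingFree (γ : Drawing G) (H : G.Subgraph) : Prop :=
  ∀ e ∈ H.edgeSet, ∀ e' ∈ G.edgeSet, e ≠ e' → γ.emap e ∩ γ.emap e' = ∅

/-- A sequence of cycles `C 0, …, C (t-1)` is a nest in `γ`: the cycles are pairwise
edge-disjoint, each is crossing-free in `γ`, and the image of each cycle is contained
in the closed disk bounded by the image of the previous one. -/
def Drawing.IsNest (γ : Drawing G) {t : ℕ} (C : Fin t → G.Subgraph) : Prop :=
  (∀ i, IsCycleSubgraph (C i)) ∧
  (∀ i j, i ≠ j → Disjoint (C i).edgeSet (C j).edgeSet) ∧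
  (∀ i, γ.CrossingFree (C i)) ∧
  (∀ i : ℕ, ∀ h : i + 1 < t,
    γ.image (C ⟨i + 1, h⟩) ⊆ closedRegion (γ.image (C ⟨i, by omega⟩)))

/-- An `s`-nest: a nest such that any two distinct cycles intersect exactly in a fixed
set `X` of `s` vertices. -/
def Drawing.IsSNest (γ : Drawing G) (s : ℕ) {t : ℕ} (C : Fin t → G.Subgraph) : Prop :=
  γ.IsNest C ∧ ∃ X : Set V, X.Finite ∧ X.ncard = s ∧
    ∀ i j, i ≠ j → (C i).verts ∩ (C j).verts = X

/-- A nest `C 0, …, C (t-1)` in `γ` is clean if every crossing of `γ` lies either in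
the open disk bounded by the image of the last cycle or outside the closed disk
bounded by the image of the first cycle. -/
def Drawing.IsCleanNest (γ : Drawing G) {t : ℕ} (C : Fin t → G.Subgraph) : Prop :=
  ∀ h : 0 < t, ∀ p ∈ γ.crossings,
    p ∈ boundedSide (γ.image (C ⟨t - 1, by omega⟩)) ∨
      p ∉ closedRegion (γ.image (C ⟨0, h⟩))

/-- A drawing is generic: no point lies on three distinct edges, and no two adjacent
edges cross. -/
def Drawing.Generic (γ : Drawing G) : Prop :=
  (∀ p : Plane, ∀ e₁ ∈ G.edgeSet, ∀ e₂ ∈ G.edgeSet, ∀ e₃ ∈ G.edgeSet,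
    p ∈ γ.emap e₁ → p ∈ γ.emap e₂ → p ∈ γ.emap e₃ → e₁ = e₂ ∨ e₁ = e₃ ∨ e₂ = e₃) ∧
  (∀ e ∈ G.edgeSet, ∀ e' ∈ G.edgeSet, e ≠ e' → (∃ v : V, v ∈ e ∧ v ∈ e') →
    γ.emap e ∩ γ.emap e' = ∅)

/-- The faces of a (crossing-free) drawing: the connected components of the complement
of its image. -/
def Drawing.faces (γ : Drawing G) : Set (Set Plane) :=
  {F | ∃ x, x ∉ γ.totalImage ∧ F = connectedComponentIn γ.totalImageᶜ x}

/-- The length of (the boundary of) a face: the number of edges of the graph drawn on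
its frontier. -/
def Drawing.faceLength (γ : Drawing G) (F : Set Plane) : ℕ :=
  {e | e ∈ G.edgeSet ∧ γ.emap e ⊆ frontier F}.ncard

/-- A drawing is a plane triangulation if it has no crossings and every face (including
the outer face) is bounded by a triangle of the graph. -/
def Drawing.IsPlaneTriangulation (γ : Drawing G) : Prop :=
  γ.crossings = ∅ ∧
  ∀ F ∈ γ.faces, ∃ T : G.Subgraph, IsCycleSubgraph T ∧ T.verts.ncard = 3 ∧
    frontier F = γ.image T



open scoped unitInterval in
/-- Any continuous nonvanishing complex function on the unit square has a continuous logarithm. -/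
lemma exists_log_sq (f : I × I → ℂ) (hf : Continuous f) (h0 : ∀ z, f z ≠ 0) :
    ∃ L : I × I → ℂ, Continuous L ∧ ∀ z, Complex.exp (L z) = f z := by
  have hp : Continuous (Set.projIcc (0 : ℝ) 1 zero_le_one) := continuous_projIcc
  let g : ℝ × ℝ → ℂ := fun z => f (Set.projIcc 0 1 zero_le_one z.1, Set.projIcc 0 1 zero_le_one z.2)
  have hg : Continuous g := by
    refine hf.comp ?_
    exact (hp.comp continuous_fst).prodMk (hp.comp continuous_snd)
  obtain ⟨F, ⟨-, hF⟩, -⟩ := Complex.isCoveringMapOn_exp.existsUnique_continuousMap_lifts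
    (A := ℝ × ℝ) ⟨g, hg⟩ (a₀ := (0, 0)) (Complex.exp_log (h0 _)) (fun a => h0 _)
  refine ⟨fun z => F (z.1, z.2), by fun_prop, fun z => ?_⟩
  have := congrFun hF ((z.1 : ℝ), (z.2 : ℝ))
  simpa [g] using this

open scoped unitInterval in
/-- Two continuous logarithms of the same function on the interval have the same increment. -/
lemma log_incr_eq (L L' : I → ℂ) (hL : Continuous L) (hL' : Continuous L')
    (h : ∀ t, Complex.exp (L t) = Complex.exp (L' t)) (s t : I) : L s - L t = L' s - L' t := by
  have hc : Continuous fun t => L t - L' t := hL.sub hL'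
  have h1 : ∀ t, ∃ n : ℤ, L t - L' t = n * (2 * Real.pi * Complex.I) := by
    intro t
    obtain ⟨n, hn⟩ := Complex.exp_eq_exp_iff_exists_int.1 (h t)
    exact ⟨n, by rw [hn]; ring⟩
  choose n hn using h1
  have hn' : ∀ t, ((n t : ℤ) : ℝ) = ((L t - L' t) / (2 * Real.pi * Complex.I)).re := by
    intro t
    rw [hn t, mul_div_assoc, div_self Complex.two_pi_I_ne_zero]
    simp
  have hcn : Continuous fun t => ((n t : ℤ) : ℝ) := by
    simp_rw [hn']
    exact Complex.continuous_re.comp (hc.div_const _)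
  have hcn2 : Continuous n := by
    have := Int.isClosedEmbedding_coe_real.isInducing.continuous_iff (f := n)
    exact this.2 hcn
  have : n s = n t := PreconnectedSpace.constant inferInstance hcn2
  have h2 := hn s
  have h3 := hn t
  rw [this] at h2
  have : L s - L' s = L t - L' t := h2.trans h3.symm
  linear_combination this

open scoped unitInterval in
/-- The relation between the increments of logarithms for two disjoint paths. -/
lemma log_rel (e f : I → ℂ) (he : Continuous e) (hf : Continuous f)
    (hd : ∀ s t, e s ≠ f t)
    (L0 L1 M0 M1 : I → ℂ) (cL0 : Continuous L0) (cL1 : Continuous L1)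
    (cM0 : Continuous M0) (cM1 : Continuous M1)
    (hL0 : ∀ t, Complex.exp (L0 t) = e t - f 0) (hL1 : ∀ t, Complex.exp (L1 t) = e t - f 1)
    (hM0 : ∀ t, Complex.exp (M0 t) = f t - e 0) (hM1 : ∀ t, Complex.exp (M1 t) = f t - e 1) :
    (L0 1 - L0 0) + (M1 1 - M1 0) = (L1 1 - L1 0) + (M0 1 - M0 0) := by
  obtain ⟨Λ, hΛ, hΛe⟩ := exists_log_sq (fun z => e z.1 - f z.2) (by fun_prop)
    (fun z => sub_ne_zero.2 (hd _ _))
  have key : ∀ x y : ℂ, Complex.exp (x + Real.pi * Complex.I) = y ↔ Complex.exp x = - y := by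
    intro x y
    rw [Complex.exp_add, Complex.exp_pi_mul_I]
    constructor
    · rintro rfl; ring
    · intro h; rw [h]; ring
  have h1 := log_incr_eq L0 (fun s => Λ (s, 0)) cL0 (by fun_prop)
    (fun t => by rw [hL0, hΛe]) 1 0
  have h2 := log_incr_eq L1 (fun s => Λ (s, 1)) cL1 (by fun_prop)
    (fun t => by rw [hL1, hΛe]) 1 0
  have h3 := log_incr_eq M0 (fun s => Λ (0, s) + Real.pi * Complex.I) cM0 (by fun_prop)
    (fun t => by rw [hM0, Eq.comm, key, hΛe]; ring) 1 0
  have h4 := log_incr_eq M1 (fun s => Λ (1, s) + Real.pi * Complex.I) cM1 (by fun_prop)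
    (fun t => by rw [hM1, Eq.comm, key, hΛe]; ring) 1 0
  rw [h1, h2, h3, h4]
  ring

open scoped unitInterval in
/-- Existence of a path logarithm. -/
lemma exists_log_path (f : I → ℂ) (hf : Continuous f) (h0 : ∀ z, f z ≠ 0) :
    ∃ L : I → ℂ, Continuous L ∧ ∀ z, Complex.exp (L z) = f z := by
  obtain ⟨L, hL, h⟩ := exists_log_sq (fun z => f z.1) (by fun_prop) (fun z => h0 _)
  exact ⟨fun s => L (s, 0), by fun_prop, fun z => by rw [h]⟩

/-- A system of logarithms of differences, antisymmetric up to `π i` in a fixed way. -/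
lemma exists_mu (x : Fin 3 → ℂ) (hx : ∀ i j, i ≠ j → x i ≠ x j) :
    ∃ μ : Fin 3 → Fin 3 → ℂ, (∀ i j, i ≠ j → Complex.exp (μ i j) = x i - x j) ∧
      ∀ i j, i < j → μ j i = μ i j + Real.pi * Complex.I := by
  refine ⟨fun i j => if i < j then Complex.log (x i - x j)
    else Complex.log (x j - x i) + Real.pi * Complex.I, ?_, ?_⟩
  · intro i j hij
    dsimp only
    split_ifs
    · exact Complex.exp_log (sub_ne_zero.2 (hx i j hij))
    · rw [Complex.exp_add, Complex.exp_pi_mul_I, Complex.exp_log (sub_ne_zero.2 (hx j i hij.symm))]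
      ring
  · intro i j hij
    dsimp only
    rw [if_neg (not_lt.2 hij.le), if_pos hij]

open scoped unitInterval in
/-- Nonplanarity of `K_{3,3}` (only independent edges are required to be disjoint). -/
lemma k33_complex (x y : Fin 3 → ℂ) (e : Fin 3 → Fin 3 → I → ℂ)
    (he : ∀ i j, Continuous (e i j)) (h0 : ∀ i j, e i j 0 = x i) (h1 : ∀ i j, e i j 1 = y j)
    (hd : ∀ i j i' j', i ≠ i' → j ≠ j' → ∀ s t, e i j s ≠ e i' j' t) : False := by
  have hex : ∀ i : Fin 3, ∃ j : Fin 3, i ≠ j := by decide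
  have hx : ∀ i j, i ≠ j → x i ≠ x j := by
    intro i j hij
    rw [← h0 i 0, ← h0 j 1]
    exact hd _ _ _ _ hij (by decide) _ _
  have hy : ∀ i j, i ≠ j → y i ≠ y j := by
    intro i j hij
    rw [← h1 0 i, ← h1 1 j]
    exact hd _ _ _ _ (by decide) hij _ _
  have hxy : ∀ i j, y j ≠ x i := by
    intro i j
    obtain ⟨i', hi'⟩ := hex i
    obtain ⟨j', hj'⟩ := hex j
    rw [← h1 i' j, ← h0 i j']
    exact hd _ _ _ _ hi'.symm hj' _ _
  obtain ⟨μ, hμ, hμ'⟩ := exists_mu x hx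
  obtain ⟨ν, hν, hν'⟩ := exists_mu y hy
  obtain ⟨l, hl⟩ : ∃ l : Fin 3 → Fin 3 → ℂ, ∀ i j, Complex.exp (l i j) = y j - x i :=
    ⟨fun i j => Complex.log (y j - x i), fun i j => Complex.exp_log (sub_ne_zero.2 (hxy i j))⟩
  have hP : ∀ i' i j, ∃ L : I → ℂ, i ≠ i' → (Continuous L ∧
      ∀ t, Complex.exp (L t) = e i j t - x i') := by
    intro i' i j
    by_cases h : i = i'
    · exact ⟨fun _ => 0, fun hh => absurd h hh⟩
    · obtain ⟨j', hj'⟩ := hex j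
      obtain ⟨L, hL⟩ := exists_log_path (fun t => e i j t - x i')
        ((he i j).sub continuous_const)
        (fun t => sub_ne_zero.2 (by rw [← h0 i' j']; exact hd _ _ _ _ h hj' _ _))
      exact ⟨L, fun _ => hL⟩
  have hQ : ∀ j' i j, ∃ L : I → ℂ, j ≠ j' → (Continuous L ∧
      ∀ t, Complex.exp (L t) = e i j t - y j') := by
    intro j' i j
    by_cases h : j = j'
    · exact ⟨fun _ => 0, fun hh => absurd h hh⟩
    · obtain ⟨i', hi'⟩ := hex i
      obtain ⟨L, hL⟩ := exists_log_path (fun t => e i j t - y j')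
        ((he i j).sub continuous_const)
        (fun t => sub_ne_zero.2 (by rw [← h1 i' j']; exact hd _ _ _ _ hi' h _ _))
      exact ⟨L, fun _ => hL⟩
  choose P hP using hP
  choose Q hQ using hQ
  have hN : ∀ i' i j, ∃ n : ℤ, i ≠ i' →
      P i' i j 1 - P i' i j 0 = l i' j - μ i i' + n * (2 * Real.pi * Complex.I) := by
    intro i' i j
    by_cases h : i = i'
    · exact ⟨0, fun hh => absurd h hh⟩
    · obtain ⟨-, hh⟩ := hP i' i j h
      have a1 : Complex.exp (P i' i j 1 - P i' i j 0) = Complex.exp (l i' j - μ i i') := by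
        rw [Complex.exp_sub, Complex.exp_sub, hh, hh, hl, hμ _ _ h, h0, h1]
      obtain ⟨n, hn⟩ := Complex.exp_eq_exp_iff_exists_int.1 a1
      exact ⟨n, fun _ => hn⟩
  have hM : ∀ j' i j, ∃ n : ℤ, j ≠ j' →
      Q j' i j 1 - Q j' i j 0 =
        ν j j' - (l i j' + Real.pi * Complex.I) + n * (2 * Real.pi * Complex.I) := by
    intro j' i j
    by_cases h : j = j'
    · exact ⟨0, fun hh => absurd h hh⟩
    · obtain ⟨-, hh⟩ := hQ j' i j h
      have a1 : Complex.exp (Q j' i j 1 - Q j' i j 0) =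
          Complex.exp (ν j j' - (l i j' + Real.pi * Complex.I)) := by
        rw [Complex.exp_sub, Complex.exp_sub, hh, hh, Complex.exp_add, Complex.exp_pi_mul_I,
          hl, hν _ _ h, h0, h1]
        congr 1
        ring
      obtain ⟨n, hn⟩ := Complex.exp_eq_exp_iff_exists_int.1 a1
      exact ⟨n, fun _ => hn⟩
  choose N hN using hN
  choose M hM using hM
  have hpi : (2 * Real.pi * Complex.I : ℂ) ≠ 0 := Complex.two_pi_I_ne_zero
  have rel : ∀ i i' j j', i ≠ i' → j ≠ j' →
      (l i' j - μ i i' + N i' i j * (2 * Real.pi * Complex.I)) +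
      (ν j' j - (l i' j + Real.pi * Complex.I) + M j i' j' * (2 * Real.pi * Complex.I)) =
      (ν j j' - (l i j' + Real.pi * Complex.I) + M j' i j * (2 * Real.pi * Complex.I)) +
      (l i j' - μ i' i + N i i' j' * (2 * Real.pi * Complex.I)) := by
    intro i i' j j' hi hj
    rw [← hN i' i j hi, ← hM j i' j' hj.symm, ← hM j' i j hj, ← hN i i' j' hi.symm]
    have p1 := hP i' i j hi
    have p2 := hQ j i' j' hj.symm
    have p3 := hQ j' i j hj
    have p4 := hP i i' j' hi.symm
    have hdis := hd i j i' j' hi hj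
    refine log_rel (e i j) (e i' j') (he _ _) (he _ _) hdis
      _ _ _ _ p1.1 p3.1 p4.1 p2.1 ?_ ?_ ?_ ?_
    · intro t; rw [p1.2, h0]
    · intro t; rw [p3.2, h1]
    · intro t; rw [p4.2, h0]
    · intro t; rw [p2.2, h1]
  have rel1 : ∀ i i' j j', i < i' → j < j' →
      N i' i j + M j i' j' - M j' i j - N i i' j' = -1 := by
    intro i i' j j' hi hj
    have := rel i i' j j' hi.ne hj.ne
    rw [hμ' i i' hi, hν' j j' hj] at this
    have h2 : ((N i' i j + M j i' j' - M j' i j - N i i' j' + 1 : ℤ) : ℂ) *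
        (2 * Real.pi * Complex.I) = 0 := by
      push_cast
      linear_combination this
    have h3 := (mul_eq_zero.1 h2).resolve_right hpi
    have h4 : N i' i j + M j i' j' - M j' i j - N i i' j' + 1 = 0 := by exact_mod_cast h3
    omega
  have rel2 : ∀ i i' j j', i < i' → j' < j →
      N i' i j + M j i' j' - M j' i j - N i i' j' = 0 := by
    intro i i' j j' hi hj
    have := rel i i' j j' hi.ne hj.ne'
    rw [hμ' i i' hi, hν' j' j hj] at this
    have h2 : ((N i' i j + M j i' j' - M j' i j - N i i' j' : ℤ) : ℂ) *
        (2 * Real.pi * Complex.I) = 0 := by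
      push_cast
      linear_combination this
    have h3 := (mul_eq_zero.1 h2).resolve_right hpi
    exact_mod_cast h3
  have l01 : (0 : Fin 3) < 1 := by decide
  have l02 : (0 : Fin 3) < 2 := by decide
  have l12 : (1 : Fin 3) < 2 := by decide
  have q1 := rel1 0 1 0 1 l01 l01
  have q2 := rel1 0 1 0 2 l01 l02
  have q3 := rel1 0 1 1 2 l01 l12
  have q4 := rel1 0 2 0 1 l02 l01
  have q5 := rel1 0 2 0 2 l02 l02
  have q6 := rel1 0 2 1 2 l02 l12
  have q7 := rel1 1 2 0 1 l12 l01
  have q8 := rel1 1 2 0 2 l12 l02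
  have q9 := rel1 1 2 1 2 l12 l12
  have r1 := rel2 0 1 1 0 l01 l01
  have r2 := rel2 0 1 2 0 l01 l02
  have r3 := rel2 0 1 2 1 l01 l12
  have r4 := rel2 0 2 1 0 l02 l01
  have r5 := rel2 0 2 2 0 l02 l02
  have r6 := rel2 0 2 2 1 l02 l12
  have r7 := rel2 1 2 1 0 l12 l01
  have r8 := rel2 1 2 2 0 l12 l02
  have r9 := rel2 1 2 2 1 l12 l12
  omega

/-- The identification of the plane with `ℂ`. -/
def toC (p : Plane) : ℂ := ⟨p.1, p.2⟩

lemma continuous_toC : Continuous toC := Complex.equivRealProdCLM.symm.continuous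

lemma toC_inj {p q : Plane} (h : toC p = toC q) : p = q := by
  have h1 := congrArg Complex.re h
  have h2 := congrArg Complex.im h
  exact Prod.ext h1 h2

/-- Nonplanarity of `K_{3,3}`, in terms of `JoinedIn`. -/
lemma k33 (x y : Fin 3 → Plane) (E : Fin 3 → Fin 3 → Set Plane)
    (hj : ∀ i j, JoinedIn (E i j) (x i) (y j))
    (hd : ∀ i j i' j', i < i' → j ≠ j' → Disjoint (E i j) (E i' j')) : False := by
  refine k33_complex (fun i => toC (x i)) (fun i => toC (y i))
    (fun i j t => toC ((hj i j).somePath t)) ?_ ?_ ?_ ?_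
  · intro i j
    exact continuous_toC.comp (hj i j).somePath.continuous
  · intro i j; simp
  · intro i j; simp
  · intro i j i' j' hi hjj s t h
    have h := toC_inj h
    have hs := (hj i j).somePath_mem s
    have ht := (hj i' j').somePath_mem t
    rw [h] at hs
    rcases lt_or_gt_of_ne hi with hi | hi
    · exact Set.disjoint_left.1 (hd i j i' j' hi hjj) hs ht
    · exact Set.disjoint_left.1 (hd i' j' i j hi hjj.symm) ht hs


/-- Membership in the outer region. -/
lemma not_mem_closedRegion {K : Set Plane} {p : Plane} :
    p ∉ closedRegion K ↔ p ∉ K ∧ ¬ IsBounded (connectedComponentIn Kᶜ p) := by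
  simp only [closedRegion, boundedSide, mem_union, mem_ofPred_eq, not_or, not_and]
  tauto

lemma subset_closedRegion (K : Set Plane) : K ⊆ closedRegion K := subset_union_left

lemma component_subset_outer {K : Set Plane} {p : Plane} (hp : p ∉ closedRegion K) :
    connectedComponentIn Kᶜ p ⊆ (closedRegion K)ᶜ := by
  intro q hq
  rw [not_mem_closedRegion] at hp
  rw [mem_compl_iff, not_mem_closedRegion, ← connectedComponentIn_eq hq]
  exact ⟨connectedComponentIn_subset _ _ hq, hp.2⟩

lemma isOpen_outer {K : Set Plane} (hK : IsClosed K) : IsOpen (closedRegion K)ᶜ := by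
  rw [isOpen_iff_mem_nhds]
  intro p hp
  have h := (not_mem_closedRegion.1 hp).1
  refine Filter.mem_of_superset
    ((hK.isOpen_compl.connectedComponentIn (x := p)).mem_nhds (mem_connectedComponentIn h))
    (component_subset_outer hp)

lemma closedRegion_mono {S K : Set Plane} (h : S ⊆ closedRegion K) :
    closedRegion S ⊆ closedRegion K := by
  intro p hp
  by_contra hpK
  have h1 := component_subset_outer hpK
  have h2 := not_mem_closedRegion.1 hpK
  have h3 : connectedComponentIn Kᶜ p ⊆ connectedComponentIn Sᶜ p :=
    isPreconnected_connectedComponentIn.subset_connectedComponentIn (mem_connectedComponentIn h2.1)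
      (h1.trans (compl_subset_compl.2 h))
  have h4 : p ∉ S := fun hh => hpK (h hh)
  exact (not_mem_closedRegion.2 ⟨h4, fun hb => h2.2 (hb.subset h3)⟩) hp

lemma one_lt_rank_plane : 1 < Module.rank ℝ Plane := by
  rw [rank_prod']
  simp only [Module.rank_self]
  norm_num

lemma isPreconnected_far (R : ℝ) (hR : 0 ≤ R) : IsPreconnected {z : Plane | R < ‖z‖} := by
  have h1 : IsPreconnected ({0}ᶜ : Set Plane) :=
    (isConnected_compl_singleton_of_one_lt_rank one_lt_rank_plane 0).isPreconnected
  have h2 : {z : Plane | R < ‖z‖} = (fun z : Plane => (1 + R * ‖z‖⁻¹) • z) '' {0}ᶜ := by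
    ext z
    simp only [mem_ofPred_eq, mem_image, mem_compl_iff, mem_singleton_iff]
    constructor
    · intro h
      have hz : 0 < ‖z‖ := lt_of_le_of_lt hR h
      refine ⟨(1 - R * ‖z‖⁻¹) • z, ?_, ?_⟩
      · have : R * ‖z‖⁻¹ < 1 := by
          rw [← div_eq_mul_inv, div_lt_one hz]; exact h
        refine smul_ne_zero (by linarith) (norm_pos_iff.1 hz)
      · have h3 : R * ‖z‖⁻¹ < 1 := by
          rw [← div_eq_mul_inv, div_lt_one hz]; exact h
        have h4 : ‖(1 - R * ‖z‖⁻¹) • z‖ = ‖z‖ - R := by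
          rw [norm_smul, Real.norm_eq_abs, abs_of_pos (by linarith)]
          field_simp
        rw [h4, smul_smul]
        have h5 : 0 < ‖z‖ - R := by linarith
        have : (1 + R * (‖z‖ - R)⁻¹) * (1 - R * ‖z‖⁻¹) = 1 := by
          field_simp
          ring
        rw [this, one_smul]
    · rintro ⟨w, hw, rfl⟩
      have hw : 0 < ‖w‖ := norm_pos_iff.2 hw
      have : 0 ≤ R * ‖w‖⁻¹ := by positivity
      rw [norm_smul, Real.norm_eq_abs, abs_of_pos (by linarith)]
      have : (1 + R * ‖w‖⁻¹) * ‖w‖ = ‖w‖ + R := by field_simp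
      linarith
  rw [h2]
  refine h1.image _ ?_
  intro z hz
  have hz : ‖z‖ ≠ 0 := norm_ne_zero_iff.2 hz
  refine ContinuousAt.continuousWithinAt ?_
  have : ContinuousAt (fun z : Plane => ‖z‖⁻¹) z := continuousAt_id.norm.inv₀ hz
  fun_prop

lemma unbounded_far (R : ℝ) : ¬ IsBounded {z : Plane | R < ‖z‖} := by
  intro h
  obtain ⟨C, hC⟩ := h.exists_norm_le
  have h1 : ‖((|R| + |C| + 1, 0) : Plane)‖ = |R| + |C| + 1 := by
    rw [Prod.norm_def]
    simp only [Real.norm_eq_abs, abs_zero]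
    rw [abs_of_nonneg (by positivity), max_eq_left (by positivity)]
  have := hC ((|R| + |C| + 1, 0) : Plane) (by
    rw [mem_ofPred_eq, h1]
    have := le_abs_self R
    have := abs_nonneg C
    linarith)
  rw [h1] at this
  have := le_abs_self C
  have := abs_nonneg R
  linarith

/-- A compact set lies in a ball whose exterior is a connected subset of the complement. -/
lemma exists_far {K : Set Plane} (hK : IsCompact K) :
    ∃ R : ℝ, 0 ≤ R ∧ {z : Plane | R < ‖z‖} ⊆ Kᶜ := by
  obtain ⟨C, hC⟩ := hK.isBounded.exists_norm_le
  refine ⟨|C|, abs_nonneg _, fun z hz hzK => ?_⟩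
  have := hC z hzK
  have := le_abs_self C
  have : |C| < ‖z‖ := hz
  linarith

lemma far_outer {K : Set Plane} (hK : IsCompact K) :
    ∃ R : ℝ, ∀ q : Plane, R < ‖q‖ → q ∉ closedRegion K := by
  obtain ⟨R, hR, h⟩ := exists_far hK
  refine ⟨R, fun q hq => not_mem_closedRegion.2 ⟨h hq, fun hb => unbounded_far R (hb.subset ?_)⟩⟩
  exact (isPreconnected_far R hR).subset_connectedComponentIn hq h

lemma exists_outer {K : Set Plane} (hK : IsCompact K) : ∃ q, q ∉ closedRegion K := by
  obtain ⟨R, h⟩ := far_outer hK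
  have : ∃ q : Plane, R < ‖q‖ := by
    by_contra hh
    push Not at hh
    exact unbounded_far R (by
      have : {z : Plane | R < ‖z‖} = ∅ := by
        ext z; simpa using hh z
      rw [this]; exact Bornology.isBounded_empty)
  obtain ⟨q, hq⟩ := this
  exact ⟨q, h q hq⟩

lemma outer_same_component {K : Set Plane} (hK : IsCompact K) {p q : Plane}
    (hp : p ∉ closedRegion K) (hq : q ∉ closedRegion K) :
    q ∈ connectedComponentIn Kᶜ p := by
  obtain ⟨R, hR, h⟩ := exists_far hK
  have key : ∀ x, x ∉ closedRegion K → ∃ y ∈ connectedComponentIn Kᶜ x, R < ‖y‖ := by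
    intro x hx
    by_contra hh
    push Not at hh
    exact (not_mem_closedRegion.1 hx).2
      (Metric.isBounded_closedBall (x := (0 : Plane)) (r := R) |>.subset
        fun y hy => by simpa using hh y hy)
  obtain ⟨p', hp', hp'R⟩ := key p hp
  obtain ⟨q', hq', hq'R⟩ := key q hq
  have h1 := (isPreconnected_far R hR).subset_connectedComponentIn (x := p') hp'R h hq'R
  rw [connectedComponentIn_eq hp', connectedComponentIn_eq h1, ← connectedComponentIn_eq hq']
  exact mem_connectedComponentIn (not_mem_closedRegion.1 hq).1

lemma outer_joined {K : Set Plane} (hK : IsCompact K) {p q : Plane}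
    (hp : p ∉ closedRegion K) (hq : q ∉ closedRegion K) :
    JoinedIn (closedRegion K)ᶜ p q := by
  have h1 := outer_same_component hK hp hq
  have h2 : IsPathConnected (connectedComponentIn Kᶜ p) := by
    rw [← (hK.isClosed.isOpen_compl.connectedComponentIn).isConnected_iff_isPathConnected]
    exact isConnected_connectedComponentIn_iff.2 (not_mem_closedRegion.1 hp).1
  exact (h2.joinedIn p (mem_connectedComponentIn (not_mem_closedRegion.1 hp).1) q h1).mono
    (component_subset_outer hp)

lemma closure_outer {K : Set Plane} (hK : IsClosed K) {z : Plane}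
    (hz : z ∈ closure (closedRegion K)ᶜ) (hzK : z ∉ K) : z ∉ closedRegion K := by
  have ho : IsOpen (connectedComponentIn Kᶜ z) := hK.isOpen_compl.connectedComponentIn
  obtain ⟨w, hw1, hw2⟩ := mem_closure_iff.1 hz _ ho (mem_connectedComponentIn hzK)
  refine not_mem_closedRegion.2 ⟨hzK, ?_⟩
  rw [connectedComponentIn_eq hw1]
  exact (not_mem_closedRegion.1 hw2).2

/-- `S` is an arc with ends `a` and `b`. -/
def IsArc (S : Set Plane) (a b : Plane) : Prop :=
  ∃ f : ℝ → Plane, ContinuousOn f (Icc 0 1) ∧ InjOn f (Icc 0 1) ∧ f 0 = a ∧ f 1 = b ∧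
    S = f '' Icc 0 1

lemma IsArc.isCompact {S : Set Plane} {a b : Plane} (h : IsArc S a b) : IsCompact S := by
  obtain ⟨f, hc, -, -, -, rfl⟩ := h
  exact isCompact_Icc.image_of_continuousOn hc

lemma IsArc.symm {S : Set Plane} {a b : Plane} (h : IsArc S a b) : IsArc S b a := by
  obtain ⟨f, hc, hi, rfl, rfl, rfl⟩ := h
  have hm : MapsTo (fun t : ℝ => 1 - t) (Icc 0 1) (Icc 0 1) := by
    rintro t ⟨h1, h2⟩; constructor <;> linarith
  refine ⟨fun t => f (1 - t), hc.comp (by fun_prop) hm, ?_, by simp, by simp, ?_⟩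
  · intro s hs t ht hst
    have := hi (hm hs) (hm ht) hst
    linarith
  · ext z
    constructor
    · rintro ⟨t, ht, rfl⟩
      exact ⟨1 - t, hm ht, by simp⟩
    · rintro ⟨t, ht, rfl⟩
      exact ⟨1 - t, hm ht, rfl⟩

lemma IsArc.left_mem {S : Set Plane} {a b : Plane} (h : IsArc S a b) : a ∈ S := by
  obtain ⟨f, hc, hi, rfl, rfl, rfl⟩ := h
  exact ⟨0, by simp, rfl⟩

lemma IsArc.right_mem {S : Set Plane} {a b : Plane} (h : IsArc S a b) : b ∈ S := h.symm.left_mem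

lemma IsArc.ne {S : Set Plane} {a b : Plane} (h : IsArc S a b) : a ≠ b := by
  obtain ⟨f, hc, hi, rfl, rfl, rfl⟩ := h
  intro hh
  have := hi (by simp) (by simp) hh
  norm_num at this

lemma IsArc.joined {S : Set Plane} {a b x : Plane} (h : IsArc S a b) (hx : x ∈ S) (hxb : x ≠ b) :
    JoinedIn (S \ {b}) a x := by
  obtain ⟨f, hc, hi, rfl, rfl, rfl⟩ := h
  obtain ⟨t, ht, rfl⟩ := hx
  have ht1 : t < 1 := lt_of_le_of_ne ht.2 (fun h => hxb (by rw [h]))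
  have hsub : Icc 0 t ⊆ Icc (0 : ℝ) 1 := Icc_subset_Icc_right ht.2
  have h1 : IsPathConnected (f '' Icc 0 t) :=
    ((convex_Icc 0 t).isPathConnected ⟨0, by simp [ht.1]⟩).image' (hc.mono hsub)
  refine (h1.joinedIn _ ⟨0, by simp [ht.1], rfl⟩ _ ⟨t, by simp [ht.1], rfl⟩).mono ?_
  rintro _ ⟨s, hs, rfl⟩
  refine ⟨⟨s, hsub hs, rfl⟩, fun hh => ?_⟩
  have := hi (hsub hs) (by simp) hh
  linarith [hs.2]

lemma IsArc.joined_ends {S : Set Plane} {a b : Plane} (h : IsArc S a b) : JoinedIn S a b := by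
  obtain ⟨f, hc, hi, rfl, rfl, rfl⟩ := h
  have h1 : IsPathConnected (f '' Icc 0 1) :=
    ((convex_Icc 0 1).isPathConnected ⟨0, by simp⟩).image' hc
  exact h1.joinedIn _ ⟨0, by simp, rfl⟩ _ ⟨1, by simp, rfl⟩

lemma IsArc.exists_inner {S : Set Plane} {a b : Plane} (h : IsArc S a b) :
    ∃ x ∈ S, x ≠ a ∧ x ≠ b := by
  obtain ⟨f, hc, hi, rfl, rfl, rfl⟩ := h
  have hm : (1 / 2 : ℝ) ∈ Icc (0 : ℝ) 1 := by norm_num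
  refine ⟨f (1 / 2), ⟨_, hm, rfl⟩, fun hh => ?_, fun hh => ?_⟩
  · have := hi hm (by simp) hh
    norm_num at this
  · have := hi hm (by simp) hh
    norm_num at this

lemma IsArc.trans {S T : Set Plane} {a b c : Plane} (hS : IsArc S a b) (hT : IsArc T b c)
    (hd : S ∩ T ⊆ {b}) : IsArc (S ∪ T) a c := by
  obtain ⟨f, hfc, hfi, rfl, rfl, rfl⟩ := hS
  obtain ⟨g, hgc, hgi, hg0, rfl, rfl⟩ := hT
  have hm1 : MapsTo (fun t : ℝ => 2 * t) (Icc 0 (1 / 2)) (Icc 0 1) := by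
    rintro t ⟨h1, h2⟩; constructor <;> linarith
  have hm2 : MapsTo (fun t : ℝ => 2 * t - 1) (Icc (1 / 2) 1) (Icc 0 1) := by
    rintro t ⟨h1, h2⟩; constructor <;> linarith
  let h : ℝ → Plane := fun t => if t ≤ 1 / 2 then f (2 * t) else g (2 * t - 1)
  have e1 : EqOn h (fun t => f (2 * t)) (Icc 0 (1 / 2)) := by
    intro t ht
    simp only [h]
    rw [if_pos ht.2]
  have e2 : EqOn h (fun t => g (2 * t - 1)) (Icc (1 / 2) 1) := by
    intro t ht
    simp only [h]
    split_ifs with hh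
    · have : t = 1 / 2 := le_antisymm hh ht.1
      subst this
      norm_num [hg0]
    · rfl
  have hU : Icc (0 : ℝ) 1 = Icc 0 (1 / 2) ∪ Icc (1 / 2) 1 :=
    (Icc_union_Icc_eq_Icc (by norm_num) (by norm_num)).symm
  have cross : ∀ s ∈ Icc (0 : ℝ) (1 / 2), ∀ t ∈ Icc (1 / 2 : ℝ) 1, h s = h t → s = t := by
    intro s hs t ht hst
    rw [e1 hs, e2 ht] at hst
    have h1 : f (2 * s) = f 1 := hd ⟨⟨2 * s, hm1 hs, rfl⟩, ⟨2 * t - 1, hm2 ht, hst.symm⟩⟩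
    have h2 := hfi (hm1 hs) (by simp) h1
    have h3 : g (2 * t - 1) = g 0 := by
      rw [hg0, ← h1]; exact hst.symm
    have h4 := hgi (hm2 ht) (by simp) h3
    simp only at h2 h4
    linarith
  refine ⟨h, ?_, ?_, ?_, ?_, ?_⟩
  · rw [hU]
    refine ContinuousOn.union_of_isClosed ?_ ?_ isClosed_Icc isClosed_Icc
    · exact (hfc.comp (by fun_prop) hm1).congr e1
    · exact (hgc.comp (by fun_prop) hm2).congr e2
  · intro s hs t ht hst
    rw [hU] at hs ht
    rcases hs with hs | hs <;> rcases ht with ht | ht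
    · rw [e1 hs, e1 ht] at hst
      have := hfi (hm1 hs) (hm1 ht) hst
      simp only at this
      linarith
    · exact cross s hs t ht hst
    · exact (cross t ht s hs hst.symm).symm
    · rw [e2 hs, e2 ht] at hst
      have := hgi (hm2 hs) (hm2 ht) hst
      simp only at this
      linarith
  · rw [e1 (by norm_num)]; simp
  · rw [e2 (by norm_num)]; norm_num
  · have hI : h '' Icc 0 1 = h '' Icc 0 (1 / 2) ∪ h '' Icc (1 / 2) 1 := by rw [hU, image_union]
    rw [hI, e1.image_eq, e2.image_eq]
    congr 1
    · ext z
      constructor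
      · rintro ⟨t, ht, rfl⟩
        exact ⟨t / 2, ⟨by linarith [ht.1], by linarith [ht.2]⟩, by simp only; congr 1; ring⟩
      · rintro ⟨t, ht, rfl⟩
        exact ⟨_, hm1 ht, rfl⟩
    · ext z
      constructor
      · rintro ⟨t, ht, rfl⟩
        exact ⟨(t + 1) / 2, ⟨by linarith [ht.1], by linarith [ht.2]⟩, by simp only; congr 1; ring⟩
      · rintro ⟨t, ht, rfl⟩
        exact ⟨_, hm2 ht, rfl⟩

/-- There is a retraction of the plane onto an arc. -/
lemma IsArc.exists_retraction {S : Set Plane} {a b : Plane} (h : IsArc S a b) :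
    ∃ r : Plane → Plane, Continuous r ∧ (∀ z, r z ∈ S) ∧ ∀ z ∈ S, r z = z := by
  obtain ⟨f, hc, hi, rfl, rfl, rfl⟩ := h
  let e : Icc (0 : ℝ) 1 → Plane := fun t => f t
  have hec : Continuous e := continuousOn_iff_continuous_domRestrict.1 hc
  have hei : Function.Injective e := fun s t hst => Subtype.ext (hi s.2 t.2 hst)
  have he : Topology.IsClosedEmbedding e := hec.isClosedEmbedding hei
  obtain ⟨φ, hφ⟩ := ContinuousMap.exists_extension he
    (⟨fun t => (t : ℝ), continuous_subtype_val⟩ : C(Icc (0 : ℝ) 1, ℝ))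
  refine ⟨fun z => e (projIcc 0 1 zero_le_one (φ z)), ?_, ?_, ?_⟩
  · exact hec.comp (continuous_projIcc.comp φ.continuous)
  · intro z
    exact ⟨_, (projIcc 0 1 zero_le_one (φ z)).2, rfl⟩
  · rintro _ ⟨t, ht, rfl⟩
    have : φ (f t) = t := congrArg (fun g => g ⟨t, ht⟩) hφ
    simp only [this]
    rw [projIcc_of_mem zero_le_one ht]

open scoped unitInterval in
/-- An arc does not separate the plane. -/
lemma IsArc.not_mem_closedRegion {S : Set Plane} {a b p : Plane} (h : IsArc S a b) (hp : p ∉ S) :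
    p ∉ closedRegion S := by
  rw [CrossingPaper.not_mem_closedRegion]
  refine ⟨hp, fun hb => ?_⟩
  obtain ⟨r, hrc, hrS, hr⟩ := h.exists_retraction
  set U := connectedComponentIn Sᶜ p with hU
  have hUo : IsOpen U := h.isCompact.isClosed.isOpen_compl.connectedComponentIn
  have hpU : p ∈ U := mem_connectedComponentIn hp
  have hfr : ∀ z ∈ frontier U, r z = z := by
    intro z hz
    apply hr
    by_contra hzS
    have hzU : z ∉ U := by
      intro hh
      rw [hUo.frontier_eq] at hz
      exact hz.2 hh
    have ho : IsOpen (connectedComponentIn Sᶜ z) :=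
      h.isCompact.isClosed.isOpen_compl.connectedComponentIn
    obtain ⟨w, hw1, hw2⟩ := mem_closure_iff.1 (frontier_subset_closure hz) _ ho
      (mem_connectedComponentIn hzS)
    apply hzU
    rw [hU, connectedComponentIn_eq hw2, ← connectedComponentIn_eq hw1]
    exact mem_connectedComponentIn hzS
  classical
  let g : Plane → Plane := fun z => if z ∈ U then r z else z
  have hg : Continuous g := by
    refine continuous_if (fun z hz => hfr z hz) hrc.continuousOn continuousOn_id
  have hgp : ∀ z, g z ≠ p := by
    intro z
    simp only [g]
    split_ifs with hz
    · intro hh; exact hp (hh ▸ hrS z)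
    · intro hh; exact hz (hh ▸ hpU)
  obtain ⟨C, hC⟩ := hb.exists_norm_le
  let ofC : ℂ → Plane := fun z => (z.re, z.im)
  have hofC : Continuous ofC := Complex.continuous_re.prodMk Complex.continuous_im
  have htoC : ∀ z, toC (ofC z) = z := fun z => by simp [toC, ofC]
  -- radius large enough
  obtain ⟨ρ, hρ0, hρ⟩ : ∃ ρ : ℝ, 0 < ρ ∧ ∀ z : ℂ, ‖z - toC p‖ = ρ → ofC z ∉ U := by
    have hcomp : IsBounded (toC '' (Metric.closedBall 0 C)) :=
      ((isCompact_closedBall (0 : Plane) C).image continuous_toC).isBounded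
    obtain ⟨C', hC'⟩ := hcomp.exists_norm_le
    refine ⟨|C'| + ‖toC p‖ + 1, by positivity, fun z hz hzU => ?_⟩
    have h1 := hC' z ⟨ofC z, by simpa using hC _ hzU, htoC z⟩
    have h2 := norm_sub_le z (toC p)
    have h3 := le_abs_self C'
    linarith
  let w : I × I → ℂ := fun st =>
    toC p + (st.1 : ℝ) * (ρ * Complex.exp ((st.2 : ℝ) * (2 * Real.pi * Complex.I)))
  have hw : Continuous w := by fun_prop
  obtain ⟨Λ, hΛ, hΛe⟩ := exists_log_sq (fun st => toC (g (ofC (w st))) - toC p)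
    (by
      have := (continuous_toC.comp (hg.comp (hofC.comp hw)))
      exact this.sub continuous_const)
    (fun st => sub_ne_zero.2 fun hh => hgp _ (toC_inj hh))
  have w01 : ∀ s : I, w (s, 0) = w (s, 1) := by
    intro s
    simp [w]
  have w0 : ∀ t : I, w (0, t) = toC p := by
    intro t
    simp [w]
  have k1 := log_incr_eq (fun t => Λ (0, t)) (fun _ => Λ (0, 0)) (by fun_prop) (by fun_prop)
    (fun t => by rw [hΛe, hΛe, w0, w0]) 1 0
  have k2 := log_incr_eq (fun s => Λ (s, 0)) (fun s => Λ (s, 1)) (by fun_prop) (by fun_prop)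
    (fun t => by rw [hΛe, hΛe, w01]) 1 0
  have k3 := log_incr_eq (fun t => Λ (1, t))
    (fun t => Real.log ρ + (t : ℝ) * (2 * Real.pi * Complex.I)) (by fun_prop) (by fun_prop)
    (fun t => by
      rw [hΛe]
      have hn : ofC (w (1, t)) ∉ U := by
        apply hρ
        simp only [w]
        have : Complex.exp ((t : ℝ) * (2 * Real.pi * Complex.I)) =
          Complex.exp (((t : ℝ) * (2 * Real.pi) : ℝ) * Complex.I) := by
          congr 1; push_cast; ring
        rw [this]
        rw [add_sub_cancel_left]
        simp only [Icc.coe_one, Complex.ofReal_one, one_mul]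
        rw [norm_mul, Complex.norm_exp_ofReal_mul_I, Complex.norm_real, Real.norm_eq_abs,
          abs_of_pos hρ0, mul_one]
      simp only [g]
      rw [if_neg hn, htoC, Complex.exp_add, ← Complex.ofReal_exp, Real.exp_log hρ0]
      simp [w]) 1 0
  have : (2 * Real.pi * Complex.I : ℂ) = 0 := by
    simp only [Icc.coe_one, Icc.coe_zero, Complex.ofReal_one, Complex.ofReal_zero] at k1 k2 k3
    linear_combination k1 - k2 - k3
  exact Complex.two_pi_I_ne_zero this


lemma disj_outer {K S T : Set Plane} (h : S ⊆ K) (hT : T ⊆ S) : Disjoint T (closedRegion K)ᶜ := by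
  rw [disjoint_compl_right_iff_subset]
  exact hT.trans (h.trans (subset_closedRegion K))

lemma disj_ends {S T : Set Plane} {a b : Plane} (h : S ∩ T ⊆ {a, b}) :
    Disjoint (S \ {b}) (T \ {a}) := by
  rw [Set.disjoint_left]
  rintro z ⟨hz1, hz2⟩ ⟨hz3, hz4⟩
  rcases h ⟨hz1, hz3⟩ with h | h
  · exact hz4 h
  · exact hz2 h

/-- Among three internally disjoint arcs with the same ends, one lies in the closed disk bounded
by the other two. -/
lemma theta {A B P : Set Plane} {a b : Plane} (hA : IsArc A a b) (hB : IsArc B a b)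
    (hP : IsArc P a b) (hAB : A ∩ B ⊆ {a, b}) (hAP : A ∩ P ⊆ {a, b}) (hBP : B ∩ P ⊆ {a, b}) :
    P ⊆ closedRegion (A ∪ B) ∨ A ⊆ closedRegion (B ∪ P) ∨ B ⊆ closedRegion (A ∪ P) := by
  by_contra hcon
  push Not at hcon
  obtain ⟨h1, h2, h3⟩ := hcon
  obtain ⟨p, hpP, hp⟩ := not_subset.1 h1
  obtain ⟨u, huA, hu⟩ := not_subset.1 h2
  obtain ⟨v, hvB, hv⟩ := not_subset.1 h3
  obtain ⟨R1, hR1⟩ := far_outer (hA.isCompact.union hB.isCompact)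
  obtain ⟨R2, hR2⟩ := far_outer (hB.isCompact.union hP.isCompact)
  obtain ⟨R3, hR3⟩ := far_outer (hA.isCompact.union hP.isCompact)
  obtain ⟨q, hq⟩ : ∃ q : Plane, max R1 (max R2 R3) < ‖q‖ := by
    by_contra hh
    push Not at hh
    exact unbounded_far (max R1 (max R2 R3)) (by
      have : {z : Plane | max R1 (max R2 R3) < ‖z‖} = ∅ := by
        ext z
        simp only [mem_ofPred_eq, mem_empty_iff_false, iff_false, not_lt]
        exact hh z
      rw [this]; exact Bornology.isBounded_empty)
  simp only [max_lt_iff] at hq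
  have hq1 := hR1 q hq.1
  have hq2 := hR2 q hq.2.1
  have hq3 := hR3 q hq.2.2
  have hpa : p ≠ a := fun h => hp (subset_closedRegion _ (Or.inl (h ▸ hA.left_mem)))
  have hpb : p ≠ b := fun h => hp (subset_closedRegion _ (Or.inl (h ▸ hA.right_mem)))
  have hua : u ≠ a := fun h => hu (subset_closedRegion _ (Or.inl (h ▸ hB.left_mem)))
  have hub : u ≠ b := fun h => hu (subset_closedRegion _ (Or.inl (h ▸ hB.right_mem)))
  have hva : v ≠ a := fun h => hv (subset_closedRegion _ (Or.inl (h ▸ hA.left_mem)))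
  have hvb : v ≠ b := fun h => hv (subset_closedRegion _ (Or.inl (h ▸ hA.right_mem)))
  have hBA : B ∩ A ⊆ {a, b} := by rwa [inter_comm]
  have hPA : P ∩ A ⊆ {a, b} := by rwa [inter_comm]
  have hPB : P ∩ B ⊆ {a, b} := by rwa [inter_comm]
  refine k33 ![a, b, q] ![u, v, p]
    ![![A \ {b}, B \ {b}, P \ {b}], ![A \ {a}, B \ {a}, P \ {a}],
      ![(closedRegion (B ∪ P))ᶜ, (closedRegion (A ∪ P))ᶜ, (closedRegion (A ∪ B))ᶜ]] ?_ ?_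
  · intro i j
    fin_cases i <;> fin_cases j
    · exact hA.joined huA hub
    · exact hB.joined hvB hvb
    · exact hP.joined hpP hpb
    · exact hA.symm.joined huA hua
    · exact hB.symm.joined hvB hva
    · exact hP.symm.joined hpP hpa
    · exact outer_joined (hB.isCompact.union hP.isCompact) hq2 hu
    · exact outer_joined (hA.isCompact.union hP.isCompact) hq3 hv
    · exact outer_joined (hA.isCompact.union hB.isCompact) hq1 hp
  · intro i j i' j' hi hj
    fin_cases i <;> fin_cases i' <;> first | (exfalso; revert hi; decide) | skip
    · fin_cases j <;> fin_cases j' <;> first | (exfalso; exact hj rfl) | skip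
      · exact disj_ends hAB
      · exact disj_ends hAP
      · exact disj_ends hBA
      · exact disj_ends hBP
      · exact disj_ends hPA
      · exact disj_ends hPB
    · fin_cases j <;> fin_cases j' <;> first | (exfalso; exact hj rfl) | skip
      · exact disj_outer subset_union_left sdiff_subset
      · exact disj_outer subset_union_left sdiff_subset
      · exact disj_outer subset_union_left sdiff_subset
      · exact disj_outer subset_union_right sdiff_subset
      · exact disj_outer subset_union_right sdiff_subset
      · exact disj_outer subset_union_right sdiff_subset
    · fin_cases j <;> fin_cases j' <;> first | (exfalso; exact hj rfl) | skip
      · exact disj_outer subset_union_left sdiff_subset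
      · exact disj_outer subset_union_left sdiff_subset
      · exact disj_outer subset_union_left sdiff_subset
      · exact disj_outer subset_union_right sdiff_subset
      · exact disj_outer subset_union_right sdiff_subset
      · exact disj_outer subset_union_right sdiff_subset

/-- The outer face of a closed curve `A ∪ L` has an inner point of the arc `A` in its closure. -/
lemma exists_mem_closure_outer {A L : Set Plane} {a c : Plane} (hA : IsArc A a c)
    (hL : IsArc L a c) (h : A ∩ L ⊆ {a, c}) :
    ∃ x ∈ A, x ≠ a ∧ x ≠ c ∧ x ∈ closure (closedRegion (A ∪ L))ᶜ := by
  by_contra hcon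
  push Not at hcon
  have hK : IsCompact (A ∪ L) := hA.isCompact.union hL.isCompact
  obtain ⟨q, hq⟩ := exists_outer hK
  have hLq : q ∉ L := fun hh => hq (subset_closedRegion _ (Or.inr hh))
  have hpre : IsPreconnected (connectedComponentIn Lᶜ q) := isPreconnected_connectedComponentIn
  have hsub : connectedComponentIn Lᶜ q ⊆ (closedRegion (A ∪ L))ᶜ := by
    refine hpre.subset_of_closure_inter_subset (isOpen_outer hK.isClosed)
      ⟨q, mem_connectedComponentIn hLq, hq⟩ ?_
    rintro z ⟨hz1, hz2⟩
    have hzL : z ∉ L := connectedComponentIn_subset _ _ hz2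
    refine closure_outer hK.isClosed hz1 ?_
    rintro (hzA | hzL')
    · refine hcon z hzA (fun e => hzL (e ▸ hL.left_mem)) (fun e => hzL (e ▸ hL.right_mem)) hz1
    · exact hzL hzL'
  obtain ⟨x, hx, hxa, hxc⟩ := hA.exists_inner
  have hxL : x ∉ L := fun hh => by
    rcases h ⟨hx, hh⟩ with h | h
    · exact hxa h
    · exact hxc h
  have := outer_same_component hL.isCompact (hL.not_mem_closedRegion hLq)
    (hL.not_mem_closedRegion hxL)
  exact hsub this (subset_closedRegion _ (Or.inl hx))

/-- Two chords of a closed curve with interleaved ends cannot be disjoint and both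
inside the closed disk. -/
lemma chords {A1 A2 A3 A4 P Q : Set Plane} {a b c d : Plane}
    (h1 : IsArc A1 a c) (h2 : IsArc A2 c b) (h3 : IsArc A3 b d) (h4 : IsArc A4 d a)
    (h12 : A1 ∩ A2 ⊆ {c}) (h13 : A1 ∩ A3 ⊆ ∅) (h23 : A2 ∩ A3 ⊆ {b}) (h24 : A2 ∩ A4 ⊆ ∅)
    (h34 : A3 ∩ A4 ⊆ {d}) (h41 : A4 ∩ A1 ⊆ {a})
    (hP : IsArc P a b) (hQ : IsArc Q c d) (hPQ : P ∩ Q ⊆ ∅)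
    (hPD : P ∩ (A1 ∪ A2 ∪ A3 ∪ A4) ⊆ {a, b}) (hQD : Q ∩ (A1 ∪ A2 ∪ A3 ∪ A4) ⊆ {c, d})
    (hPi : P ⊆ closedRegion (A1 ∪ A2 ∪ A3 ∪ A4))
    (hQi : Q ⊆ closedRegion (A1 ∪ A2 ∪ A3 ∪ A4)) : False := by
  set D := A1 ∪ A2 ∪ A3 ∪ A4 with hD
  have hDc : IsCompact D :=
    ((h1.isCompact.union h2.isCompact).union h3.isCompact).union h4.isCompact
  -- the complementary arcs
  have hL1 : IsArc (A2 ∪ A3 ∪ A4) a c := by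
    refine ((h2.trans h3 h23).trans h4 ?_).symm
    rintro z ⟨hz | hz, hz'⟩
    · exact (h24 ⟨hz, hz'⟩).elim
    · exact h34 ⟨hz, hz'⟩
  have hL3 : IsArc (A4 ∪ A1 ∪ A2) b d := by
    refine ((h4.trans h1 h41).trans h2 ?_).symm
    rintro z ⟨hz | hz, hz'⟩
    · exact (h24 ⟨hz', hz⟩).elim
    · exact h12 ⟨hz, hz'⟩
  obtain ⟨x1, hx1, hx1a, hx1c, hx1o⟩ := exists_mem_closure_outer h1 hL1 (by
    rintro z ⟨hz, (hz' | hz') | hz'⟩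
    · right; exact h12 ⟨hz, hz'⟩
    · exact (h13 ⟨hz, hz'⟩).elim
    · left; exact h41 ⟨hz', hz⟩)
  obtain ⟨x3, hx3, hx3b, hx3d, hx3o⟩ := exists_mem_closure_outer h3 hL3 (by
    rintro z ⟨hz, (hz' | hz') | hz'⟩
    · right; exact h34 ⟨hz, hz'⟩
    · exact (h13 ⟨hz', hz⟩).elim
    · left; exact h23 ⟨hz', hz⟩)
  have e1 : A1 ∪ (A2 ∪ A3 ∪ A4) = D := by rw [hD]; simp only [union_assoc]
  have e3 : A3 ∪ (A4 ∪ A1 ∪ A2) = D := by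
    rw [hD]; ext z; simp only [mem_union]; tauto
  rw [e1] at hx1o
  rw [e3] at hx3o
  have hN1 : x1 ∉ A2 ∪ A3 ∪ A4 ∪ P ∪ Q := by
    rintro ((((hz | hz) | hz) | hz) | hz)
    · exact hx1c (h12 ⟨hx1, hz⟩)
    · exact (h13 ⟨hx1, hz⟩)
    · exact hx1a (h41 ⟨hz, hx1⟩)
    · rcases hPD ⟨hz, Or.inl (Or.inl (Or.inl hx1))⟩ with e | e
      · exact hx1a e
      · refine h13 ⟨hx1, ?_⟩
        rw [show x1 = b from e]; exact h3.left_mem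
    · rcases hQD ⟨hz, Or.inl (Or.inl (Or.inl hx1))⟩ with e | e
      · exact hx1c e
      · refine h13 ⟨hx1, ?_⟩
        rw [show x1 = d from e]; exact h3.right_mem
  have hN3 : x3 ∉ A1 ∪ A2 ∪ A4 ∪ P ∪ Q := by
    rintro ((((hz | hz) | hz) | hz) | hz)
    · exact (h13 ⟨hz, hx3⟩)
    · exact hx3b (h23 ⟨hz, hx3⟩)
    · exact hx3d (h34 ⟨hx3, hz⟩)
    · rcases hPD ⟨hz, Or.inl (Or.inr hx3)⟩ with e | e
      · refine h13 ⟨?_, hx3⟩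
        rw [show x3 = a from e]; exact h1.left_mem
      · exact hx3b e
    · rcases hQD ⟨hz, Or.inl (Or.inr hx3)⟩ with e | e
      · refine h13 ⟨?_, hx3⟩
        rw [show x3 = c from e]; exact h1.right_mem
      · exact hx3d e
  have hcl1 : IsClosed (A2 ∪ A3 ∪ A4 ∪ P ∪ Q) :=
    ((((h2.isCompact.union h3.isCompact).union h4.isCompact).union hP.isCompact).union
      hQ.isCompact).isClosed
  have hcl3 : IsClosed (A1 ∪ A2 ∪ A4 ∪ P ∪ Q) :=
    ((((h1.isCompact.union h2.isCompact).union h4.isCompact).union hP.isCompact).union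
      hQ.isCompact).isClosed
  obtain ⟨r1, hr1, hb1⟩ := Metric.isOpen_iff.1 hcl1.isOpen_compl x1 hN1
  obtain ⟨r3, hr3, hb3⟩ := Metric.isOpen_iff.1 hcl3.isOpen_compl x3 hN3
  obtain ⟨w1, hw1, hw1o⟩ := mem_closure_iff.1 hx1o _ Metric.isOpen_ball (Metric.mem_ball_self hr1)
  obtain ⟨w3, hw3, hw3o⟩ := mem_closure_iff.1 hx3o _ Metric.isOpen_ball (Metric.mem_ball_self hr3)
  have hball : ∀ (x w : Plane) (r : ℝ), 0 < r → w ∈ Metric.ball x r →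
      JoinedIn (Metric.ball x r) x w := fun x w r hr hw =>
    ((convex_ball x r).isPathConnected ⟨x, Metric.mem_ball_self hr⟩).joinedIn _
      (Metric.mem_ball_self hr) _ hw
  set O := (closedRegion D)ᶜ with hO
  set B1 := Metric.ball x1 r1 with hB1
  set B3 := Metric.ball x3 r3 with hB3
  have hj : JoinedIn (O ∪ B1 ∪ B3) x3 x1 := by
    refine ((hball x3 w3 r3 hr3 hw3).mono subset_union_right).trans ?_
    refine ((outer_joined hDc hw3o hw1o).mono ?_).trans ?_
    · exact fun z hz => Or.inl (Or.inl hz)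
    · exact ((hball x1 w1 r1 hr1 hw1).symm.mono fun z hz => Or.inl (Or.inr hz))
  have dj : ∀ S : Set Plane, S ⊆ closedRegion D → S ⊆ A2 ∪ A3 ∪ A4 ∪ P ∪ Q →
      S ⊆ A1 ∪ A2 ∪ A4 ∪ P ∪ Q → Disjoint S (O ∪ B1 ∪ B3) := by
    intro S hS1 hS2 hS3
    rw [Set.disjoint_left]
    rintro z hz ((h | h) | h)
    · exact h (hS1 hz)
    · exact hb1 h (hS2 hz)
    · exact hb3 h (hS3 hz)
  have sD : D ⊆ closedRegion D := subset_closedRegion D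
  refine k33 ![a, c, x3] ![x1, b, d]
    ![![A1 \ {c}, P, A4], ![A1 \ {a}, A2, Q], ![O ∪ B1 ∪ B3, A3 \ {d}, A3 \ {b}]] ?_ ?_
  · intro i j
    fin_cases i <;> fin_cases j
    · exact h1.joined hx1 hx1c
    · exact hP.joined_ends
    · exact h4.symm.joined_ends
    · exact h1.symm.joined hx1 hx1a
    · exact h2.joined_ends
    · exact hQ.joined_ends
    · exact hj
    · exact (h3.joined hx3 hx3d).symm
    · exact (h3.symm.joined hx3 hx3b).symm
  · have ca : c ≠ a := h1.ne.symm
    have cb : c ≠ b := h2.ne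
    have bd : b ≠ d := h3.ne
    have da : d ≠ a := h4.ne
    have ab : a ≠ b := hP.ne
    have cd : c ≠ d := hQ.ne
    intro i j i' j' hi hj
    fin_cases i <;> fin_cases i' <;> first | (exfalso; revert hi; decide) | skip
    · fin_cases j <;> fin_cases j' <;> first | (exfalso; exact hj rfl) | skip
      · show Disjoint (A1 \ {c}) A2
        rw [Set.disjoint_left]
        exact fun z hz hz' => hz.2 (h12 ⟨hz.1, hz'⟩)
      · show Disjoint (A1 \ {c}) Q
        rw [Set.disjoint_left]
        intro z hz hz'
        rcases hQD ⟨hz', Or.inl (Or.inl (Or.inl hz.1))⟩ with e | e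
        · exact hz.2 e
        · refine h13 ⟨hz.1, ?_⟩
          rw [show z = d from e]; exact h3.right_mem
      · show Disjoint P (A1 \ {a})
        rw [Set.disjoint_left]
        intro z hz hz'
        rcases hPD ⟨hz, Or.inl (Or.inl (Or.inl hz'.1))⟩ with e | e
        · exact hz'.2 e
        · refine h13 ⟨hz'.1, ?_⟩
          rw [show z = b from e]; exact h3.left_mem
      · show Disjoint P Q
        rw [Set.disjoint_left]
        exact fun z hz hz' => hPQ ⟨hz, hz'⟩
      · show Disjoint A4 (A1 \ {a})
        rw [Set.disjoint_left]
        exact fun z hz hz' => hz'.2 (h41 ⟨hz, hz'.1⟩)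
      · show Disjoint A4 A2
        rw [Set.disjoint_left]
        exact fun z hz hz' => h24 ⟨hz', hz⟩
    · fin_cases j <;> fin_cases j' <;> first | (exfalso; exact hj rfl) | skip
      · show Disjoint (A1 \ {c}) (A3 \ {d})
        rw [Set.disjoint_left]
        exact fun z hz hz' => h13 ⟨hz.1, hz'.1⟩
      · show Disjoint (A1 \ {c}) (A3 \ {b})
        rw [Set.disjoint_left]
        exact fun z hz hz' => h13 ⟨hz.1, hz'.1⟩
      · exact dj P hPi (fun z hz => Or.inl (Or.inr hz)) (fun z hz => Or.inl (Or.inr hz))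
      · show Disjoint P (A3 \ {b})
        rw [Set.disjoint_left]
        intro z hz hz'
        rcases hPD ⟨hz, Or.inl (Or.inr hz'.1)⟩ with e | e
        · refine h13 ⟨?_, hz'.1⟩
          rw [show z = a from e]; exact h1.left_mem
        · exact hz'.2 e
      · exact dj A4 ((subset_union_right).trans sD) (fun z hz => Or.inl (Or.inl (Or.inr hz)))
          (fun z hz => Or.inl (Or.inl (Or.inr hz)))
      · show Disjoint A4 (A3 \ {d})
        rw [Set.disjoint_left]
        exact fun z hz hz' => hz'.2 (h34 ⟨hz'.1, hz⟩)
    · fin_cases j <;> fin_cases j' <;> first | (exfalso; exact hj rfl) | skip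
      · show Disjoint (A1 \ {a}) (A3 \ {d})
        rw [Set.disjoint_left]
        exact fun z hz hz' => h13 ⟨hz.1, hz'.1⟩
      · show Disjoint (A1 \ {a}) (A3 \ {b})
        rw [Set.disjoint_left]
        exact fun z hz hz' => h13 ⟨hz.1, hz'.1⟩
      · exact dj A2 (fun z hz => sD (Or.inl (Or.inl (Or.inr hz))))
          (fun z hz => Or.inl (Or.inl (Or.inl (Or.inl hz))))
          (fun z hz => Or.inl (Or.inl (Or.inl (Or.inr hz))))
      · show Disjoint A2 (A3 \ {b})
        rw [Set.disjoint_left]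
        exact fun z hz hz' => hz'.2 (h23 ⟨hz, hz'.1⟩)
      · exact dj Q hQi (fun z hz => Or.inr hz) (fun z hz => Or.inr hz)
      · show Disjoint Q (A3 \ {d})
        rw [Set.disjoint_left]
        intro z hz hz'
        rcases hQD ⟨hz, Or.inl (Or.inr hz'.1)⟩ with e | e
        · refine h13 ⟨?_, hz'.1⟩
          rw [show z = c from e]; exact h1.right_mem
        · exact hz'.2 e


/-- `c` runs periodically around the cycle `H` of length `n`. -/
structure CycParam (H : G.Subgraph) (n : ℕ) (c : ℕ → V) : Prop where
  three : 3 ≤ n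
  per : ∀ i, c (i + n) = c i
  inj : ∀ i j, i < j → j < i + n → c i ≠ c j
  verts : ∀ v, v ∈ H.verts ↔ ∃ i, c i = v
  adj : ∀ u v, H.Adj u v ↔ ∃ i, s(u, v) = s(c i, c (i + 1))

lemma exists_cycParam {H : G.Subgraph} (h : IsCycleSubgraph H) : ∃ n c, CycParam H n c := by
  obtain ⟨hconn, hfin, hdeg⟩ := h
  have : Finite H.verts := hfin
  have : H.coe.LocallyFinite := fun v => Fintype.ofFinite _
  have hdeg' : ∀ v : H.verts, (H.coe.neighborSet v).ncard = 2 := by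
    intro v
    rw [← hdeg v v.2, ← Nat.card_coe_set_eq, ← Nat.card_coe_set_eq]
    exact Nat.card_congr (SimpleGraph.Subgraph.coeNeighborSetEquiv v)
  have hcyc : H.coe.IsCycles := fun v _ => hdeg' v
  obtain ⟨v, hv⟩ := hconn.nonempty
  obtain ⟨p, hp, hps⟩ := hcyc.exists_cycle_toSubgraph_verts_eq_connectedComponentSupp
    (v := ⟨v, hv⟩) (c := H.coe.connectedComponentMk ⟨v, hv⟩) rfl
    (Set.nonempty_of_ncard_ne_zero (by rw [hdeg']; norm_num))
  have hall : ∀ w : H.verts, w ∈ p.toSubgraph.verts := by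
    intro w
    rw [hps]
    exact SimpleGraph.ConnectedComponent.sound (hconn.coe.preconnected _ _)
  have hlen := hp.three_le_length
  set n := p.length with hn
  have hn0 : 0 < n := by omega
  have hinj : ∀ i j, i < n → j < n → p.getVert i = p.getVert j → i = j := by
    intro i j hi hj hij
    exact hp.getVert_injOn' (by rw [mem_ofPred_eq]; omega) (by rw [mem_ofPred_eq]; omega) hij
  have hsucc : ∀ i, p.getVert ((i + 1) % n) = p.getVert (i % n + 1) := by
    intro i
    have h1 := Nat.mod_lt i hn0
    rcases Nat.lt_or_ge (i % n + 1) n with h | h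
    · rw [Nat.add_mod, Nat.mod_eq_of_lt (show 1 < n by omega), Nat.mod_eq_of_lt h]
    · have h2 : i % n + 1 = n := by omega
      rw [Nat.add_mod, Nat.mod_eq_of_lt (show 1 < n by omega), h2, Nat.mod_self, hn]
      simp
  refine ⟨n, fun i => (p.getVert (i % n) : V), hlen, fun i => by simp, ?_, ?_, ?_⟩
  · intro i j hij hj heq
    have h1 := hinj _ _ (Nat.mod_lt i hn0) (Nat.mod_lt j hn0) (Subtype.ext heq)
    have h2 : (j - i) % n = 0 := Nat.sub_mod_eq_zero_of_mod_eq h1.symm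
    rw [Nat.mod_eq_of_lt (by omega)] at h2
    omega
  · intro w
    constructor
    · intro hw
      have h1 := hall ⟨w, hw⟩
      rw [SimpleGraph.Walk.mem_verts_toSubgraph,
        SimpleGraph.Walk.mem_support_iff_exists_getVert] at h1
      obtain ⟨i, hi, hi'⟩ := h1
      rcases Nat.lt_or_ge i n with h | h
      · exact ⟨i, by simp [Nat.mod_eq_of_lt h, hi]⟩
      · refine ⟨0, ?_⟩
        have : i = p.length := by omega
        subst this
        simp at hi
        simp [← hi]
    · rintro ⟨i, rfl⟩
      exact (p.getVert (i % n)).2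
  · intro u w
    have key : ∀ u w : H.verts, H.Adj u w ↔ p.toSubgraph.Adj u w := fun u w =>
      ((hp.adj_toSubgraph_iff_of_isCycles hcyc (hall u) w).symm)
    simp only [hsucc]
    constructor
    · intro h
      have h1 := (key ⟨u, H.edge_vert h⟩ ⟨w, H.edge_vert h.symm⟩).1 h
      obtain ⟨i, hi, hi'⟩ := p.toSubgraph_adj_iff.1 h1
      refine ⟨i, ?_⟩
      rw [Nat.mod_eq_of_lt hi']
      have := congrArg (Sym2.map Subtype.val) hi
      simpa using this.symm
    · rintro ⟨i, hi⟩
      have h1 := p.toSubgraph_adj_getVert (Nat.mod_lt i hn0)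
      have h2 := (key _ _).2 h1
      rw [← SimpleGraph.Subgraph.mem_edgeSet] at h2 ⊢
      rwa [hi]


lemma CycParam.per_mul {H : G.Subgraph} {n : ℕ} {c : ℕ → V} (h : CycParam H n c) (i t : ℕ) :
    c (i + n * t) = c i := by
  induction t with
  | zero => simp
  | succ t ih => rw [Nat.mul_succ, ← add_assoc, h.per, ih]

lemma CycParam.mod {H : G.Subgraph} {n : ℕ} {c : ℕ → V} (h : CycParam H n c) (i : ℕ) :
    c (i % n) = c i := by
  conv_rhs => rw [← Nat.mod_add_div i n]
  rw [h.per_mul]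

lemma CycParam.eq_iff {H : G.Subgraph} {n : ℕ} {c : ℕ → V} (h : CycParam H n c) {i j : ℕ} :
    c i = c j ↔ i % n = j % n := by
  have h3 := h.three
  have hi := Nat.mod_lt i (show n > 0 by omega)
  have hj := Nat.mod_lt j (show n > 0 by omega)
  constructor
  · intro he
    rw [← h.mod i, ← h.mod j] at he
    rcases lt_trichotomy (i % n) (j % n) with hl | hl | hl
    · exact (h.inj _ _ hl (by omega) he).elim
    · exact hl
    · exact (h.inj _ _ hl (by omega) he.symm).elim
  · intro he
    rw [← h.mod i, ← h.mod j, he]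

lemma CycParam.shift {H : G.Subgraph} {n : ℕ} {c : ℕ → V} (h : CycParam H n c) {i j : ℕ}
    (hij : c i = c j) (l : ℕ) : c (i + l) = c (j + l) := by
  rw [h.eq_iff] at hij ⊢
  rw [Nat.add_mod, hij, ← Nat.add_mod]

/-- Every vertex of the cycle has an index in the window starting at `i`. -/
lemma CycParam.window {H : G.Subgraph} {n : ℕ} {c : ℕ → V} (h : CycParam H n c) (i : ℕ) {v : V}
    (hv : v ∈ H.verts) : ∃ j, i ≤ j ∧ j < i + n ∧ c j = v := by
  obtain ⟨t, rfl⟩ := (h.verts v).1 hv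
  have h3 := h.three
  have ht := Nat.mod_lt t (show n > 0 by omega)
  have hi := Nat.mod_lt i (show n > 0 by omega)
  have hid := Nat.mod_add_div i n
  rcases Nat.lt_or_ge (t % n) (i % n) with hl | hl
  · refine ⟨t % n + n * (i / n) + n, by omega, by omega, ?_⟩
    rw [h.per, h.per_mul, h.mod]
  · refine ⟨t % n + n * (i / n), by omega, by omega, ?_⟩
    rw [h.per_mul, h.mod]

lemma CycParam.inj' {H : G.Subgraph} {n : ℕ} {c : ℕ → V} (h : CycParam H n c) {i j s : ℕ}
    (hi : s ≤ i) (hi' : i < s + n) (hj : s ≤ j) (hj' : j < s + n) (hij : c i = c j) : i = j := by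
  rcases lt_trichotomy i j with hl | hl | hl
  · exact (h.inj _ _ hl (by omega) hij).elim
  · exact hl
  · exact (h.inj _ _ hl (by omega) hij.symm).elim

lemma CycParam.mem {H : G.Subgraph} {n : ℕ} {c : ℕ → V} (h : CycParam H n c) (i : ℕ) :
    c i ∈ H.verts := (h.verts _).2 ⟨i, rfl⟩

lemma CycParam.adj_succ {H : G.Subgraph} {n : ℕ} {c : ℕ → V} (h : CycParam H n c) (i : ℕ) :
    H.Adj (c i) (c (i + 1)) := (h.adj _ _).2 ⟨i, rfl⟩

lemma CycParam.adj_cases {H : G.Subgraph} {n : ℕ} {c : ℕ → V} (h : CycParam H n c) {i j : ℕ}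
    (hij : i < j) (hj : j < i + n) (ha : H.Adj (c i) (c j)) : j = i + 1 ∨ j + 1 = i + n := by
  have h3 := h.three
  obtain ⟨l, hl⟩ := (h.adj _ _).1 ha
  rw [Sym2.eq_iff] at hl
  rcases hl with ⟨h1, h2⟩ | ⟨h1, h2⟩
  · left
    have := h.shift h1 1
    exact h.inj' (s := i) (by omega) (by omega) (by omega) (by omega) (h2.trans this.symm)
  · right
    have h4 := h.shift h2 1
    rw [← h1, ← h.per i] at h4
    exact h.inj' (s := i + 1) (by omega) (by omega) (by omega) (by omega) h4

/-- The point set drawn by a set of vertices and a set of edges. -/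
def Drawing.gim (γ : Drawing G) (U : Set V) (F : Set (Sym2 V)) : Set Plane :=
  γ.vmap '' U ∪ ⋃ e ∈ F, γ.emap e

lemma Drawing.gim_union (γ : Drawing G) (U U' : Set V) (F F' : Set (Sym2 V)) :
    γ.gim U F ∪ γ.gim U' F' = γ.gim (U ∪ U') (F ∪ F') := by
  simp only [Drawing.gim, image_union, biUnion_union]
  ext z
  simp only [mem_union]
  tauto

lemma Drawing.gim_mono (γ : Drawing G) {U U' : Set V} {F F' : Set (Sym2 V)} (hU : U ⊆ U')
    (hF : F ⊆ F') : γ.gim U F ⊆ γ.gim U' F' :=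
  union_subset_union (image_mono hU) (biUnion_subset_biUnion_left hF)

lemma Drawing.gim_inter (γ : Drawing G) {U U' : Set V} {F F' : Set (Sym2 V)}
    (hF : F ⊆ G.edgeSet) (hF' : F' ⊆ G.edgeSet)
    (hcf : ∀ e ∈ F, ∀ e' ∈ G.edgeSet, e ≠ e' → γ.emap e ∩ γ.emap e' = ∅)
    (hd : ∀ e ∈ F, e ∉ F') : γ.gim U F ∩ γ.gim U' F' ⊆ γ.vmap '' (U ∩ U') := by
  rintro z ⟨hz | hz, hz' | hz'⟩
  · obtain ⟨u, hu, rfl⟩ := hz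
    obtain ⟨v, hv, hvu⟩ := hz'
    have := γ.vmap_inj hvu
    subst this
    exact ⟨v, ⟨hu, hv⟩, rfl⟩
  · obtain ⟨u, hu, rfl⟩ := hz
    simp only [mem_iUnion] at hz'
    obtain ⟨e, he, hz'⟩ := hz'
    exact (γ.avoid e (hF' he) u hz').elim
  · obtain ⟨u, hu, rfl⟩ := hz'
    simp only [mem_iUnion] at hz
    obtain ⟨e, he, hz⟩ := hz
    exact (γ.avoid e (hF he) u hz).elim
  · simp only [mem_iUnion] at hz hz'
    obtain ⟨e, he, hz⟩ := hz
    obtain ⟨e', he', hz'⟩ := hz'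
    have := hcf e he e' (hF' he') (fun h => hd e he (h ▸ he'))
    have h2 : z ∈ (∅ : Set Plane) := this ▸ ⟨hz, hz'⟩
    exact h2.elim

/-- The vertices and edges of the segment from `i` to `j`. -/
def segV (c : ℕ → V) (i j : ℕ) : Set V := c '' Icc i j

def segE (c : ℕ → V) (i j : ℕ) : Set (Sym2 V) := (fun l => s(c l, c (l + 1))) '' Ico i j

/-- The image of a segment. -/
def Drawing.seg (γ : Drawing G) (c : ℕ → V) (i j : ℕ) : Set Plane := γ.gim (segV c i j) (segE c i j)

lemma Drawing.seg_union (γ : Drawing G) (c : ℕ → V) {i j k : ℕ} (hij : i ≤ j) (hjk : j ≤ k) :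
    γ.seg c i j ∪ γ.seg c j k = γ.seg c i k := by
  rw [Drawing.seg, Drawing.seg, Drawing.gim_union, segV, segV, segE, segE, ← image_union,
    ← image_union, Ico_union_Ico_eq_Ico hij hjk, Icc_union_Icc_eq_Icc hij hjk]
  rfl

lemma CycParam.segV_subset {H : G.Subgraph} {n : ℕ} {c : ℕ → V} (h : CycParam H n c) (i j : ℕ) :
    segV c i j ⊆ H.verts := by
  rintro _ ⟨l, -, rfl⟩
  exact h.mem l

lemma CycParam.segE_subset {H : G.Subgraph} {n : ℕ} {c : ℕ → V} (h : CycParam H n c) (i j : ℕ) :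
    segE c i j ⊆ H.edgeSet := by
  rintro _ ⟨l, -, rfl⟩
  exact h.adj_succ l

lemma CycParam.seg_subset {H : G.Subgraph} {n : ℕ} {c : ℕ → V} (h : CycParam H n c)
    (γ : Drawing G) (i j : ℕ) : γ.seg c i j ⊆ γ.image H :=
  γ.gim_mono (h.segV_subset i j) (h.segE_subset i j)

lemma CycParam.seg_full {H : G.Subgraph} {n : ℕ} {c : ℕ → V} (h : CycParam H n c)
    (γ : Drawing G) (i : ℕ) : γ.seg c i (i + n) = γ.image H := by
  refine (h.seg_subset γ _ _).antisymm (γ.gim_mono ?_ ?_)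
  · intro v hv
    obtain ⟨j, h1, h2, rfl⟩ := h.window i hv
    exact ⟨j, ⟨h1, h2.le⟩, rfl⟩
  · intro e he
    induction e with | _ u v =>
    obtain ⟨l, hl⟩ := (h.adj _ _).1 he
    obtain ⟨j, h1, h2, h3⟩ := h.window i (h.mem l)
    refine ⟨j, ⟨h1, h2⟩, ?_⟩
    rw [hl]
    simp only [h3, h.shift h3 1]

lemma CycParam.seg_shift {H : G.Subgraph} {n : ℕ} {c : ℕ → V} (h : CycParam H n c)
    (γ : Drawing G) (i j : ℕ) : γ.seg c (i + n) (j + n) = γ.seg c i j := by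
  have h1 : ∀ l, c (l + n + 1) = c (l + 1) := fun l => by
    rw [add_right_comm, h.per]
  have hV : segV c (i + n) (j + n) = segV c i j := by
    ext v
    constructor
    · rintro ⟨l, ⟨hl, hl'⟩, rfl⟩
      refine ⟨l - n, ⟨by omega, by omega⟩, ?_⟩
      rw [← h.per, Nat.sub_add_cancel (by omega)]
    · rintro ⟨l, ⟨hl, hl'⟩, rfl⟩
      exact ⟨l + n, ⟨by omega, by omega⟩, h.per l⟩
  have hE : segE c (i + n) (j + n) = segE c i j := by
    ext v
    constructor
    · rintro ⟨l, ⟨hl, hl'⟩, rfl⟩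
      refine ⟨l - n, ⟨by omega, by omega⟩, ?_⟩
      have : l - n + n = l := Nat.sub_add_cancel (by omega)
      simp only
      rw [← h.per, ← h1, this]
    · rintro ⟨l, ⟨hl, hl'⟩, rfl⟩
      refine ⟨l + n, ⟨by omega, by omega⟩, ?_⟩
      simp only
      rw [h.per, h1]
  rw [Drawing.seg, hV, hE]
  rfl

lemma CycParam.seg_inter {H : G.Subgraph} {n : ℕ} {c : ℕ → V} (h : CycParam H n c)
    {γ : Drawing G} (hcf : γ.CrossingFree H) {i j k l : ℕ} (hij : i ≤ j) (hjk : j ≤ k)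
    (hkl : k ≤ l) (hl : l < i + n) :
    γ.seg c i j ∩ γ.seg c k l ⊆ {z | j = k ∧ z = γ.vmap (c j)} := by
  have hE : ∀ i j, segE c i j ⊆ G.edgeSet := fun i j => (h.segE_subset i j).trans H.edgeSet_subset
  refine (γ.gim_inter (hE _ _) (hE _ _) (fun e he => hcf e (h.segE_subset _ _ he)) ?_).trans ?_
  · rintro _ ⟨s, ⟨hs, hs'⟩, rfl⟩ ⟨t, ⟨ht, ht'⟩, hst⟩
    simp only [Sym2.eq_iff] at hst
    rcases hst with hst | hst
    · have := h.inj' (s := i) (by omega) (by omega) (by omega) (by omega) hst.1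
      omega
    · have := h.inj' (s := i) (by omega) (by omega) (by omega) (by omega) hst.2
      omega
  · rintro _ ⟨v, ⟨⟨s, ⟨hs, hs'⟩, rfl⟩, ⟨t, ⟨ht, ht'⟩, hst⟩⟩, rfl⟩
    have := h.inj' (s := i) (by omega) (by omega) (by omega) (by omega) hst
    have h1 : j = k := by omega
    have h2 : s = j := by omega
    exact ⟨h1, by rw [h2]⟩

lemma Drawing.edge_arc (γ : Drawing G) {u v : V} (h : G.Adj u v) :
    IsArc (γ.gim {u, v} {s(u, v)}) (γ.vmap u) (γ.vmap v) := by
  obtain ⟨f, hc, hi, h0, h1, he⟩ := γ.arc s(u, v) h u v rfl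
  refine ⟨f, hc, hi, h0, h1, ?_⟩
  have : Icc (0 : ℝ) 1 = {0, 1} ∪ Ioo 0 1 := by
    rw [union_comm, Ioo_union_both zero_le_one]
  rw [this, image_union, ← he, image_pair, h0, h1]
  simp [Drawing.gim, image_pair]

lemma CycParam.seg_arc {H : G.Subgraph} {n : ℕ} {c : ℕ → V} (h : CycParam H n c)
    {γ : Drawing G} (hcf : γ.CrossingFree H) {i j : ℕ} (hij : i < j) (hj : j < i + n) :
    IsArc (γ.seg c i j) (γ.vmap (c i)) (γ.vmap (c j)) := by
  have one : ∀ i, IsArc (γ.seg c i (i + 1)) (γ.vmap (c i)) (γ.vmap (c (i + 1))) := by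
    intro i
    have h1 := γ.edge_arc (h.adj_succ i).adj_sub
    have h2 : segV c i (i + 1) = {c i, c (i + 1)} := by
      rw [segV, ← image_pair]
      congr 1
      ext l
      simp only [mem_Icc, mem_insert_iff, mem_singleton_iff]
      omega
    have h3 : segE c i (i + 1) = {s(c i, c (i + 1))} := by
      have : Ico i (i + 1) = {i} := by
        ext l
        simp only [mem_Ico, mem_singleton_iff]
        omega
      rw [segE, this, image_singleton]
    rw [Drawing.seg, h2, h3]
    exact h1
  induction j, (show i + 1 ≤ j from hij) using Nat.le_induction with
  | base => exact one i
  | succ j hj' ih =>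
    rw [← γ.seg_union c (show i ≤ j by omega) (show j ≤ j + 1 by omega)]
    refine (ih (by omega) (by omega)).trans (one j) ?_
    refine (h.seg_inter hcf (by omega) le_rfl (by omega) hj).trans ?_
    rintro z ⟨-, hz⟩
    exact hz


lemma exists_adjacent_AB (A B : ℕ → Prop) : ∀ d l1 l2 : ℕ, l2 - l1 = d → l1 < l2 → A l1 → B l2 →
    ∃ l1' l2', l1 ≤ l1' ∧ l1' < l2' ∧ l2' ≤ l2 ∧ A l1' ∧ B l2' ∧
      ∀ l, l1' < l → l < l2' → ¬ A l ∧ ¬ B l := by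
  intro d
  induction d using Nat.strong_induction_on with
  | _ d ih =>
    intro l1 l2 hd hl hA hB
    by_cases h1 : ∃ l, l1 < l ∧ l < l2 ∧ A l
    · obtain ⟨l, h1, h2, h3⟩ := h1
      obtain ⟨u, v, e1, e2, e3, e4⟩ := ih (l2 - l) (by omega) l l2 rfl h2 h3 hB
      exact ⟨u, v, by omega, e2, e3, e4⟩
    by_cases h2 : ∃ l, l1 < l ∧ l < l2 ∧ B l
    · obtain ⟨l, h1, h2, h3⟩ := h2
      obtain ⟨u, v, e1, e2, e3, e4⟩ := ih (l - l1) (by omega) l1 l rfl h1 hA h3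
      exact ⟨u, v, e1, e2, by omega, e4⟩
    push Not at h1 h2
    exact ⟨l1, l2, le_rfl, hl, le_rfl, hA, hB, fun l e e' => ⟨h1 l e e', h2 l e e'⟩⟩

/-- A segment of the inner cycle between two consecutive vertices of `X` meets the
outer cycle only in its ends. -/
lemma seg_inter_image {γ : Drawing G} {H K : G.Subgraph} {n : ℕ} {c : ℕ → V}
    (hK : CycParam K n c) (hKcf : γ.CrossingFree K) {X : Set V} (hX : H.verts ∩ K.verts = X)
    {p q : ℕ} (hno : ∀ l, p < l → l < q → c l ∉ X)
    (hadj : ¬ H.Adj (c p) (c q)) :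
    γ.seg c p q ∩ γ.image H ⊆ {γ.vmap (c p), γ.vmap (c q)} := by
  have hmem : ∀ l, c l ∈ H.verts → c l ∈ X := fun l hl => hX ▸ ⟨hl, hK.mem l⟩
  refine (γ.gim_inter (U' := H.verts) ((hK.segE_subset _ _).trans K.edgeSet_subset)
    H.edgeSet_subset (fun e he => hKcf e (hK.segE_subset _ _ he)) ?_).trans ?_
  · rintro _ ⟨l, ⟨hl, hl'⟩, rfl⟩ he
    have he : H.Adj (c l) (c (l + 1)) := he
    have h1 := hmem _ (H.edge_vert he)
    have h2 := hmem _ (H.edge_vert he.symm)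
    have h3 : l = p := by
      by_contra hne
      exact hno l (by omega) hl' h1
    have h4 : l + 1 = q := by
      by_contra hne
      exact hno (l + 1) (by omega) (by omega) h2
    rw [h3, ← h3, h4, h3] at he
    exact hadj he
  · rintro _ ⟨v, ⟨⟨l, ⟨hl, hl'⟩, rfl⟩, hv⟩, rfl⟩
    have h1 := hmem _ hv
    by_cases h3 : l = p
    · left; rw [h3]
    by_cases h4 : l = q
    · right; rw [h4]; rfl
    exact (hno l (by omega) (by omega) h1).elim

/-- Two vertices consecutive in `X` along the inner cycle are consecutive in `X` along the outer
cycle. -/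
lemma consecutive {γ : Drawing G} {H K : G.Subgraph} {n n' : ℕ} {c c' : ℕ → V}
    (hH : CycParam H n c) (hK : CycParam K n' c') (hHcf : γ.CrossingFree H)
    (hKcf : γ.CrossingFree K) {X : Set V} (hX : H.verts ∩ K.verts = X)
    (hnest : γ.image K ⊆ closedRegion (γ.image H)) {p q : ℕ} (hpq : p < q) (hq : q < p + n')
    (hpX : c' p ∈ X) (hqX : c' q ∈ X) (hno : ∀ l, p < l → l < q → c' l ∉ X) :
    ∃ α β, α < β ∧ β < α + n ∧ s(c' p, c' q) = s(c α, c β) ∧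
      ∀ l, α < l → l < β → c l ∉ X := by
  have hXH : ∀ v ∈ X, v ∈ H.verts := fun v hv => (hX ▸ hv : v ∈ H.verts ∩ K.verts).1
  have hXK : ∀ v ∈ X, v ∈ K.verts := fun v hv => (hX ▸ hv : v ∈ H.verts ∩ K.verts).2
  obtain ⟨α, hα⟩ := (hH.verts _).1 (hXH _ hpX)
  obtain ⟨β, hβ1, hβ2, hβ⟩ := hH.window α (hXH _ hqX)
  have hne : c' p ≠ c' q := hK.inj p q hpq hq
  have hβ3 : α < β := by
    rcases hβ1.lt_or_eq with h | h
    · exact h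
    · subst h; exact (hne (hα.symm.trans hβ)).elim
  by_cases hs1 : ∀ l, α < l → l < β → c l ∉ X
  · exact ⟨α, β, hβ3, hβ2, by rw [hα, hβ], hs1⟩
  by_cases hs2 : ∀ l, β < l → l < α + n → c l ∉ X
  · exact ⟨β, α + n, hβ2, by omega, by rw [hH.per, hα, hβ, Sym2.eq_swap], hs2⟩
  push Not at hs1 hs2
  exfalso
  obtain ⟨g0, hg1, hg2, hgX⟩ := hs1
  obtain ⟨d0, hd1, hd2, hdX⟩ := hs2
  -- sides
  let A : ℕ → Prop := fun l => c' l ∈ X ∧ ∃ t, α < t ∧ t < β ∧ c t = c' l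
  let B : ℕ → Prop := fun l => c' l ∈ X ∧ ∃ t, β < t ∧ t < α + n ∧ c t = c' l
  have hAB : ∀ l, q < l → l < p + n' → c' l ∈ X → A l ∨ B l := by
    intro l h1 h2 hl
    obtain ⟨t, ht1, ht2, ht⟩ := hH.window α (hXH _ hl)
    rcases lt_trichotomy t β with h | h | h
    · rcases ht1.lt_or_eq with h' | h'
      · exact Or.inl ⟨hl, t, h', h, ht⟩
      · subst h'
        have := hK.inj' (s := p) (by omega) (by omega) (by omega) (by omega) (hα.symm.trans ht)
        omega
    · subst h
      have := hK.inj' (s := p) (by omega) (by omega) (by omega) (by omega) (hβ.symm.trans ht)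
      omega
    · exact Or.inr ⟨hl, t, h, ht2, ht⟩
  have hloc : ∀ t, α < t → t < α + n → t ≠ β → c t ∈ X →
      ∃ l, q < l ∧ l < p + n' ∧ c' l = c t := by
    intro t h1 h2 h3 hX'
    obtain ⟨l, hl1, hl2, hl⟩ := hK.window p (hXK _ hX')
    refine ⟨l, ?_, hl2, hl⟩
    by_contra hlq
    rcases hl1.lt_or_eq with h | h
    · rcases (not_lt.1 hlq).lt_or_eq with h' | h'
      · exact hno l h h' (hl ▸ hX')
      · subst h'
        exact h3 (hH.inj' (s := α) (by omega) (by omega) (by omega) (by omega) (hl.symm.trans hβ.symm))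
    · subst h
      have := hH.inj' (s := α) (by omega) (by omega) (by omega) (by omega) (hl.symm.trans hα.symm)
      omega
  obtain ⟨lg, hlg1, hlg2, hlg⟩ := hloc g0 hg1 (by omega) (by omega) hgX
  obtain ⟨ld, hld1, hld2, hld⟩ := hloc d0 (by omega) hd2 (by omega) hdX
  have hAg : A lg := ⟨hlg ▸ hgX, g0, hg1, hg2, hlg.symm⟩
  have hBd : B ld := ⟨hld ▸ hdX, d0, hd1, hd2, hld.symm⟩
  -- the common finish
  have finish : ∀ l1 l2 g h, q < l1 → l1 < l2 → l2 < p + n' → α < g → g < β → β < h → h < α + n →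
      (∀ l, l1 < l → l < l2 → c' l ∉ X) →
      (c' l1 = c g ∧ c' l2 = c h ∨ c' l1 = c h ∧ c' l2 = c g) → False := by
    intro l1 l2 g h e1 e2 e3 e4 e5 e6 e7 hno' hgh
    have hu : γ.seg c α g ∪ γ.seg c g β ∪ γ.seg c β h ∪ γ.seg c h (α + n) = γ.image H := by
      rw [γ.seg_union c (by omega) (by omega), γ.seg_union c (by omega) (by omega),
        γ.seg_union c (by omega) (by omega), hH.seg_full]
    have hQ : IsArc (γ.seg c' l1 l2) (γ.vmap (c g)) (γ.vmap (c h)) := by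
      have := hK.seg_arc hKcf e2 (by omega)
      rcases hgh with ⟨h1, h2⟩ | ⟨h1, h2⟩
      · rwa [h1, h2] at this
      · rw [h1, h2] at this; exact this.symm
    have hadj1 : ¬ H.Adj (c' p) (c' q) := by
      rw [← hα, ← hβ]
      intro hh
      have := hH.adj_cases hβ3 hβ2 hh
      omega
    have hadj2' : ¬ H.Adj (c g) (c h) := by
      intro hh
      have := hH.adj_cases (by omega) (by omega) hh
      omega
    have hadj2 : ¬ H.Adj (c' l1) (c' l2) := by
      rcases hgh with ⟨h1, h2⟩ | ⟨h1, h2⟩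
      · rwa [h1, h2]
      · rw [h1, h2]; exact fun hh => hadj2' hh.symm
    refine chords (hH.seg_arc hHcf e4 (by omega)) (hH.seg_arc hHcf e5 (by omega))
      (hH.seg_arc hHcf e6 (by omega))
      (show IsArc (γ.seg c h (α + n)) (γ.vmap (c h)) (γ.vmap (c α)) by
        have := hH.seg_arc hHcf e7 (by omega)
        rwa [hH.per] at this)
      (P := γ.seg c' p q) (Q := γ.seg c' l1 l2) ?_ ?_ ?_ ?_ ?_ ?_ ?_ hQ ?_ ?_ ?_ ?_ ?_
    · exact (hH.seg_inter hHcf (by omega) le_rfl (by omega) (by omega)).trans fun z hz => hz.2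
    · refine (hH.seg_inter hHcf (by omega) (by omega) (by omega) (by omega)).trans fun z hz => ?_
      have := hz.1
      omega
    · exact (hH.seg_inter hHcf (by omega) le_rfl (by omega) (by omega)).trans fun z hz => hz.2
    · refine (hH.seg_inter hHcf (by omega) (by omega) (by omega) (by omega)).trans fun z hz => ?_
      have := hz.1
      omega
    · exact (hH.seg_inter hHcf (by omega) le_rfl (by omega) (by omega)).trans fun z hz => hz.2
    · rw [← hH.seg_shift γ α g]
      refine (hH.seg_inter hHcf (by omega) le_rfl (by omega) (by omega)).trans fun z hz => ?_
      have := hz.2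
      rwa [hH.per] at this
    · have := hK.seg_arc hKcf hpq hq
      rwa [← hα, ← hβ] at this
    · refine (hK.seg_inter hKcf (by omega) (by omega) (by omega) (by omega)).trans fun z hz => ?_
      have := hz.1
      omega
    · rw [hu, hα, hβ]
      exact seg_inter_image hK hKcf hX hno hadj1
    · rw [hu]
      refine (seg_inter_image hK hKcf hX hno' hadj2).trans ?_
      rcases hgh with ⟨h1, h2⟩ | ⟨h1, h2⟩
      · rw [h1, h2]
      · rw [h1, h2, pair_comm]
    · rw [hu]
      exact (hK.seg_subset γ _ _).trans hnest
    · rw [hu]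
      exact (hK.seg_subset γ _ _).trans hnest
  rcases lt_trichotomy lg ld with hl | hl | hl
  · obtain ⟨l1, l2, f1, f2, f3, ⟨-, g, hg1, hg2, hg⟩, ⟨-, h, hh1, hh2, hh⟩, f6⟩ :=
      exists_adjacent_AB A B _ lg ld rfl hl hAg hBd
    refine finish l1 l2 g h (by omega) f2 (by omega) hg1 hg2 hh1 hh2 ?_ (Or.inl ⟨hg.symm, hh.symm⟩)
    intro l h1 h2 hlX
    rcases hAB l (by omega) (by omega) hlX with h | h
    · exact (f6 l h1 h2).1 h
    · exact (f6 l h1 h2).2 h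
  · have := hH.inj' (s := α) (by omega) (by omega) (by omega) (by omega)
      (hlg.symm.trans ((congrArg c' hl).trans hld))
    omega
  · obtain ⟨l1, l2, f1, f2, f3, ⟨-, h, hh1, hh2, hh⟩, ⟨-, g, hg1, hg2, hg⟩, f6⟩ :=
      exists_adjacent_AB B A _ ld lg rfl hl hBd hAg
    refine finish l1 l2 g h (by omega) f2 (by omega) hg1 hg2 hh1 hh2 ?_ (Or.inr ⟨hh.symm, hg.symm⟩)
    intro l h1 h2 hlX
    rcases hAB l (by omega) (by omega) hlX with h | h
    · exact (f6 l h1 h2).2 h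
    · exact (f6 l h1 h2).1 h


section arcs

variable {ι : Type} {I : ι → Set Plane} {a b : Plane}

/-- In a family of internally disjoint arcs there are two that enclose all the others. -/
lemma exists_outer_pair [DecidableEq ι] (s : Finset ι)
    (hI : ∀ i ∈ s, IsArc (I i) a b)
    (hd : ∀ i ∈ s, ∀ j ∈ s, i ≠ j → I i ∩ I j ⊆ {a, b}) (hs : 2 ≤ s.card) :
    ∃ u ∈ s, ∃ v ∈ s, u ≠ v ∧ ∀ w ∈ s, I w ⊆ closedRegion (I u ∪ I v) := by
  induction s using Finset.induction_on with
  | empty => simp at hs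
  | insert w s hw ih =>
    rw [Finset.card_insert_of_notMem hw] at hs
    rcases Nat.lt_or_ge s.card 2 with h | h
    · have h1 : s.card = 1 := by omega
      obtain ⟨u, rfl⟩ := Finset.card_eq_one.1 h1
      have huw : u ≠ w := fun e => hw (by simp [e])
      refine ⟨u, by simp, w, by simp, huw, ?_⟩
      intro x hx
      simp only [Finset.mem_insert, Finset.mem_singleton] at hx
      rcases hx with rfl | rfl
      · exact subset_union_right.trans (subset_closedRegion _)
      · exact subset_union_left.trans (subset_closedRegion _)
    · obtain ⟨u, hu, v, hv, huv, hall⟩ := ih (fun i hi => hI i (Finset.mem_insert_of_mem hi))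
        (fun i hi j hj => hd i (Finset.mem_insert_of_mem hi) j (Finset.mem_insert_of_mem hj)) h
      have hu' := Finset.mem_insert_of_mem (a := u) (b := w) hu
      have hv' := Finset.mem_insert_of_mem (a := v) (b := w) hv
      have hw' := Finset.mem_insert_self w s
      have huw : u ≠ w := fun e => hw (e ▸ hu)
      have hvw : v ≠ w := fun e => hw (e ▸ hv)
      rcases theta (hI u hu') (hI v hv') (hI w hw') (hd u hu' v hv' huv) (hd u hu' w hw' huw)
        (hd v hv' w hw' hvw) with ht | ht | ht
      · refine ⟨u, hu', v, hv', huv, fun x hx => ?_⟩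
        rcases Finset.mem_insert.1 hx with rfl | hx
        · exact ht
        · exact hall x hx
      · refine ⟨v, hv', w, hw', hvw, fun x hx => ?_⟩
        rcases Finset.mem_insert.1 hx with rfl | hx
        · exact subset_union_right.trans (subset_closedRegion _)
        · refine (hall x hx).trans (closedRegion_mono (union_subset ht ?_))
          exact subset_union_left.trans (subset_closedRegion _)
      · refine ⟨u, hu', w, hw', huw, fun x hx => ?_⟩
        rcases Finset.mem_insert.1 hx with rfl | hx
        · exact subset_union_right.trans (subset_closedRegion _)
        · refine (hall x hx).trans (closedRegion_mono (union_subset ?_ ht))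
          exact subset_union_left.trans (subset_closedRegion _)

/-- Peeling off outer pairs. -/
lemma exists_pairs [DecidableEq ι] [Nonempty ι] (k : ℕ) : ∀ (s : Finset ι),
    (∀ i ∈ s, IsArc (I i) a b) → (∀ i ∈ s, ∀ j ∈ s, i ≠ j → I i ∩ I j ⊆ {a, b}) →
    2 * k ≤ s.card →
    ∃ u v : ℕ → ι, (∀ r < k, u r ∈ s ∧ v r ∈ s ∧ u r ≠ v r) ∧
      (∀ r r', r < r' → r' < k → u r ≠ u r' ∧ u r ≠ v r' ∧ v r ≠ u r' ∧ v r ≠ v r') ∧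
      (∀ r, r + 1 < k → I (u (r + 1)) ∪ I (v (r + 1)) ⊆ closedRegion (I (u r) ∪ I (v r))) := by
  induction k with
  | zero =>
    intro s _ _ _
    obtain ⟨x⟩ := ‹Nonempty ι›
    exact ⟨fun _ => x, fun _ => x, by simp, by simp, by simp⟩
  | succ k ih =>
    intro s hI hd hs
    obtain ⟨u0, hu0, v0, hv0, huv, hall⟩ := exists_outer_pair s hI hd (by omega)
    have hsub : (s.erase u0).erase v0 ⊆ s :=
      (Finset.erase_subset _ _).trans (Finset.erase_subset _ _)
    have hcard : ((s.erase u0).erase v0).card = s.card - 2 := by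
      rw [Finset.card_erase_of_mem (Finset.mem_erase.2 ⟨huv.symm, hv0⟩),
        Finset.card_erase_of_mem hu0]
      omega
    obtain ⟨u, v, h1, h2, h3⟩ := ih ((s.erase u0).erase v0) (fun i hi => hI i (hsub hi))
      (fun i hi j hj => hd i (hsub hi) j (hsub hj)) (by omega)
    have hne : ∀ x ∈ (s.erase u0).erase v0, u0 ≠ x ∧ v0 ≠ x := by
      intro x hx
      simp only [Finset.mem_erase] at hx
      exact ⟨hx.2.1.symm, hx.1.symm⟩
    refine ⟨fun r => Nat.casesOn r u0 u, fun r => Nat.casesOn r v0 v, ?_, ?_, ?_⟩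
    · rintro (_ | r) hr
      · exact ⟨hu0, hv0, huv⟩
      · have := h1 r (by omega)
        exact ⟨hsub this.1, hsub this.2.1, this.2.2⟩
    · rintro (_ | r) (_ | r') hr hr'
      · omega
      · have := h1 r' (by omega)
        exact ⟨(hne _ this.1).1, (hne _ this.2.1).1, (hne _ this.1).2, (hne _ this.2.1).2⟩
      · omega
      · exact h2 r r' (by omega) (by omega)
    · rintro (_ | r) hr
      · have := h1 0 (by omega)
        exact union_subset (hall _ (hsub this.1)) (hall _ (hsub this.2.1))
      · exact h3 r (by omega)

end arcs

lemma isCycle_of_paths {a b : V} {p q : G.Walk a b} (hp : p.IsPath) (hq : q.IsPath)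
    (hpq : ∀ v, v ∈ p.support → v ∈ q.support → v = a ∨ v = b) (hab : a ≠ b)
    (he : s(a, b) ∉ p.edges) : (p.append q.reverse).IsCycle := by
  cases p with
  | nil => exact (hab rfl).elim
  | cons h p =>
    rename_i w
    rw [SimpleGraph.Walk.cons_isPath_iff] at hp
    rw [SimpleGraph.Walk.cons_append, SimpleGraph.Walk.cons_isCycle_iff]
    constructor
    · rw [SimpleGraph.Walk.isPath_def, SimpleGraph.Walk.support_append, List.nodup_append]
      have hr : q.reverse.support.Nodup := hq.reverse.support_nodup
      have hr' : q.reverse.support = b :: q.reverse.support.tail :=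
        (SimpleGraph.Walk.cons_tail_support _).symm
      rw [hr', List.nodup_cons] at hr
      refine ⟨hp.1.support_nodup, hr.2, ?_⟩
      rintro x hx y hy rfl
      have hxq : x ∈ q.support := by
        have := List.mem_of_mem_tail hy
        simpa using this
      rcases hpq x (by simp [hx]) hxq with rfl | rfl
      · exact hp.2 hx
      · exact hr.1 hy
    · rw [SimpleGraph.Walk.edges_append, List.mem_append, not_or]
      constructor
      · intro hh
        exact hp.2 (SimpleGraph.Walk.fst_mem_support_of_mem_edges _ hh)
      · intro hh
        have hw : w ∈ q.support := by
          simp only [SimpleGraph.Walk.edges_reverse, List.mem_reverse] at hh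
          exact SimpleGraph.Walk.snd_mem_support_of_mem_edges _ hh
        rcases hpq w (by simp) hw with rfl | rfl
        · exact h.ne rfl
        · exact he (by simp)

lemma Drawing.image_sup (γ : Drawing G) (H K : G.Subgraph) :
    γ.image (H ⊔ K) = γ.image H ∪ γ.image K := by
  have := γ.gim_union H.verts K.verts H.edgeSet K.edgeSet
  rw [← SimpleGraph.Subgraph.verts_sup, ← SimpleGraph.Subgraph.edgeSet_sup] at this
  exact this.symm

/-- A large family of internally disjoint crossing-free paths with the same ends gives a 2-nest. -/
lemma nest_of_paths (γ : Drawing G) (k : ℕ) {ι : Type} [Nonempty ι] (s : Finset ι) {a b : V}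
    (hab : a ≠ b) (p : ι → G.Walk a b) (hs : 2 * k ≤ s.card)
    (hp : ∀ i ∈ s, (p i).IsPath) (hcf : ∀ i ∈ s, γ.CrossingFree (p i).toSubgraph)
    (harc : ∀ i ∈ s, IsArc (γ.image (p i).toSubgraph) (γ.vmap a) (γ.vmap b))
    (he : ∀ i ∈ s, s(a, b) ∉ (p i).edges)
    (hd : ∀ i ∈ s, ∀ j ∈ s, i ≠ j → ∀ v, v ∈ (p i).support → v ∈ (p j).support → v = a ∨ v = b) :
    ∃ C : Fin k → G.Subgraph, γ.IsSNest 2 C := by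
  classical
  have hedge : ∀ i ∈ s, ∀ j ∈ s, i ≠ j → ∀ e ∈ (p i).edges, e ∉ (p j).edges := by
    intro i hi j hj hij e he1 he2
    induction e with | _ x y =>
    have hx := hd i hi j hj hij x (SimpleGraph.Walk.fst_mem_support_of_mem_edges _ he1)
      (SimpleGraph.Walk.fst_mem_support_of_mem_edges _ he2)
    have hy := hd i hi j hj hij y (SimpleGraph.Walk.snd_mem_support_of_mem_edges _ he1)
      (SimpleGraph.Walk.snd_mem_support_of_mem_edges _ he2)
    have hxy : x ≠ y := ((p i).adj_of_mem_edges he1).ne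
    rcases hx with rfl | rfl <;> rcases hy with rfl | rfl
    · exact hxy rfl
    · exact he i hi he1
    · exact he i hi (Sym2.eq_swap ▸ he1)
    · exact hxy rfl
  obtain ⟨u, v, h1, h2, h3⟩ := exists_pairs (I := fun i => γ.image (p i).toSubgraph)
    (a := γ.vmap a) (b := γ.vmap b) k s harc (by
      intro i hi j hj hij
      refine (γ.gim_inter (p i).toSubgraph.edgeSet_subset (p j).toSubgraph.edgeSet_subset
        (hcf i hi) ?_).trans ?_
      · intro e he1 he2
        rw [SimpleGraph.Walk.mem_edges_toSubgraph] at he1 he2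
        exact hedge i hi j hj hij e he1 he2
      · rintro _ ⟨x, ⟨hx, hx'⟩, rfl⟩
        rw [SimpleGraph.Walk.mem_verts_toSubgraph] at hx hx'
        rcases hd i hi j hj hij x hx hx' with rfl | rfl
        · left; rfl
        · right; rfl) hs
  have h4 : ∀ r r', r ≠ r' → r < k → r' < k →
      u r ≠ u r' ∧ u r ≠ v r' ∧ v r ≠ u r' ∧ v r ≠ v r' := by
    intro r r' hrr hr hr'
    rcases lt_or_gt_of_ne hrr with h | h
    · exact h2 r r' h hr'
    · have := h2 r' r h hr
      exact ⟨this.1.symm, this.2.2.1.symm, this.2.1.symm, this.2.2.2.symm⟩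
  refine ⟨fun r => (p (u r)).toSubgraph ⊔ (p (v r)).toSubgraph, ⟨?_, ?_, ?_, ?_⟩,
    {a, b}, by simp, ncard_pair hab, ?_⟩
  · intro r
    obtain ⟨hu, hv, huv⟩ := h1 r r.2
    have hc := isCycle_of_paths (hp _ hu) (hp _ hv) (hd _ hu _ hv huv) hab (he _ hu)
    have heq : (p (u r)).toSubgraph ⊔ (p (v r)).toSubgraph =
        ((p (u r)).append (p (v r)).reverse).toSubgraph := by
      rw [SimpleGraph.Walk.toSubgraph_append, SimpleGraph.Walk.toSubgraph_reverse]
    simp only [heq]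
    refine ⟨SimpleGraph.Walk.toSubgraph_connected _, ?_, ?_⟩
    · rw [SimpleGraph.Walk.verts_toSubgraph]
      exact List.finite_toSet _
    · intro x hx
      rw [SimpleGraph.Walk.mem_verts_toSubgraph] at hx
      exact hc.ncard_neighborSet_toSubgraph_eq_two hx
  · intro r r' hrr
    have hrr' : (r : ℕ) ≠ r' := fun h => hrr (Fin.ext h)
    obtain ⟨hu, hv, huv⟩ := h1 r r.2
    obtain ⟨hu', hv', huv'⟩ := h1 r' r'.2
    obtain ⟨e1, e2, e3, e4⟩ := h4 r r' hrr' r.2 r'.2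
    rw [Set.disjoint_left]
    intro e
    simp only [SimpleGraph.Subgraph.edgeSet_sup, mem_union, SimpleGraph.Walk.mem_edges_toSubgraph,
      not_or]
    rintro (hh | hh)
    · exact ⟨hedge _ hu _ hu' e1 e hh, hedge _ hu _ hv' e2 e hh⟩
    · exact ⟨hedge _ hv _ hu' e3 e hh, hedge _ hv _ hv' e4 e hh⟩
  · intro r e hee
    obtain ⟨hu, hv, huv⟩ := h1 r r.2
    rw [SimpleGraph.Subgraph.edgeSet_sup] at hee
    rcases hee with hh | hh
    · exact hcf _ hu e hh
    · exact hcf _ hv e hh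
  · intro r hr
    simp only [Drawing.image_sup]
    exact h3 r hr
  · intro r r' hrr
    have hrr' : (r : ℕ) ≠ r' := fun h => hrr (Fin.ext h)
    obtain ⟨hu, hv, huv⟩ := h1 r r.2
    obtain ⟨hu', hv', huv'⟩ := h1 r' r'.2
    obtain ⟨e1, e2, e3, e4⟩ := h4 r r' hrr' r.2 r'.2
    ext x
    simp only [SimpleGraph.Subgraph.verts_sup, mem_inter_iff, mem_union,
      SimpleGraph.Walk.mem_verts_toSubgraph, mem_insert_iff, mem_singleton_iff]
    constructor
    · rintro ⟨hx | hx, hx' | hx'⟩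
      · exact hd _ hu _ hu' e1 x hx hx'
      · exact hd _ hu _ hv' e2 x hx hx'
      · exact hd _ hv _ hu' e3 x hx hx'
      · exact hd _ hv _ hv' e4 x hx hx'
    · rintro (rfl | rfl) <;> simp


lemma CycParam.exists_walk {H : G.Subgraph} {n : ℕ} {c : ℕ → V} (h : CycParam H n c) {i j : ℕ}
    (hij : i ≤ j) (hj : j < i + n) :
    ∃ p : G.Walk (c i) (c j), p.IsPath ∧ (∀ v, v ∈ p.support ↔ v ∈ segV c i j) ∧
      ∀ e, e ∈ p.edges ↔ e ∈ segE c i j := by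
  induction j, hij using Nat.le_induction with
  | base => exact ⟨SimpleGraph.Walk.nil, by simp, by simp [segV], by simp [segE]⟩
  | succ j hij ih =>
    obtain ⟨p, hp, hv, he⟩ := ih (by omega)
    refine ⟨p.concat (h.adj_succ j).adj_sub, ?_, ?_, ?_⟩
    · rw [SimpleGraph.Walk.concat_isPath_iff]
      refine ⟨hp, fun hh => ?_⟩
      obtain ⟨l, ⟨hl, hl'⟩, hl2⟩ := (hv _).1 hh
      have := h.inj' (s := i) (by omega) (by omega) (by omega) (by omega) hl2
      omega
    · intro v
      have : Icc i (j + 1) = insert (j + 1) (Icc i j) := by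
        ext l; simp only [mem_Icc, mem_insert_iff]; omega
      rw [SimpleGraph.Walk.support_concat, List.mem_append, hv, segV, segV,
        this, image_insert_eq]
      simp only [List.mem_singleton, mem_insert_iff]
      tauto
    · intro e
      have : Ico i (j + 1) = insert j (Ico i j) := by
        ext l; simp only [mem_Ico, mem_insert_iff]; omega
      rw [SimpleGraph.Walk.edges_concat, List.concat_eq_append, List.mem_append, he, segE, segE,
        this, image_insert_eq]
      simp only [List.mem_singleton, mem_insert_iff]
      tauto

/-- A path through `K` with ends `a`, `b`, otherwise avoiding `X`. -/
structure GoodPath (γ : Drawing G) (K : G.Subgraph) (X : Set V) {a b : V} (p : G.Walk a b) :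
    Prop where
  path : p.IsPath
  sup : ∀ v ∈ p.support, v ∈ K.verts
  edges : ∀ e ∈ p.edges, e ∈ K.edgeSet
  arc : IsArc (γ.image p.toSubgraph) (γ.vmap a) (γ.vmap b)
  ends : s(a, b) ∉ p.edges
  avoid : ∀ v ∈ p.support, v ∈ X → v = a ∨ v = b

lemma GoodPath.reverse {γ : Drawing G} {K : G.Subgraph} {X : Set V} {a b : V} {p : G.Walk a b}
    (h : GoodPath γ K X p) : GoodPath γ K X p.reverse where
  path := h.path.reverse
  sup := by simpa using h.sup
  edges := by simpa using h.edges
  arc := by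
    rw [SimpleGraph.Walk.toSubgraph_reverse]
    exact h.arc.symm
  ends := by
    rw [Sym2.eq_swap]
    simpa using h.ends
  avoid := by
    intro v hv hX
    exact (h.avoid v (by simpa using hv) hX).symm

lemma CycParam.goodPath {γ : Drawing G} {K : G.Subgraph} {n : ℕ} {c : ℕ → V}
    (h : CycParam K n c) (hcf : γ.CrossingFree K) {X : Set V} {i j : ℕ} (hij : i + 2 ≤ j)
    (hj : j < i + n) (hno : ∀ l, i < l → l < j → c l ∉ X) :
    ∃ p : G.Walk (c i) (c j), GoodPath γ K X p := by
  obtain ⟨p, hp, hv, he⟩ := h.exists_walk (show i ≤ j by omega) hj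
  refine ⟨p, hp, fun v hv' => h.segV_subset _ _ ((hv v).1 hv'),
    fun e he' => h.segE_subset _ _ ((he e).1 he'), ?_, ?_, ?_⟩
  · have : γ.image p.toSubgraph = γ.seg c i j := by
      have h1 : p.toSubgraph.verts = segV c i j := by
        ext v; rw [SimpleGraph.Walk.mem_verts_toSubgraph, hv]
      have h2 : p.toSubgraph.edgeSet = segE c i j := by
        ext v; rw [SimpleGraph.Walk.mem_edges_toSubgraph, he]
      rw [Drawing.image, h1, h2]
      rfl
    rw [this]
    exact h.seg_arc hcf (by omega) hj
  · rw [he]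
    rintro ⟨l, ⟨hl, hl'⟩, hl2⟩
    simp only [Sym2.eq_iff] at hl2
    rcases hl2 with ⟨h1, h2⟩ | ⟨h1, h2⟩
    · have := h.inj' (s := i) (by omega) (by omega) (by omega) (by omega) h1
      have := h.inj' (s := i) (by omega) (by omega) (by omega) (by omega) h2
      omega
    · have := h.inj' (s := i) (by omega) (by omega) (by omega) (by omega) h1
      omega
  · intro v hv' hX
    obtain ⟨l, ⟨hl, hl'⟩, rfl⟩ := (hv v).1 hv'
    by_cases h1 : l = i
    · left; rw [h1]
    by_cases h2 : l = j
    · right; rw [h2]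
    exact (hno l (by omega) (by omega) hX).elim

lemma CycParam.exists_segment {K : G.Subgraph} {n : ℕ} {c : ℕ → V}
    (h : CycParam K n c) {X : Set V} (hXK : X ⊆ K.verts) (hX2 : 2 ≤ X.ncard)
    {v : V} (hv : v ∈ K.verts) (hvX : v ∉ X) :
    ∃ i j, i + 2 ≤ j ∧ j < i + n ∧ c i ∈ X ∧ c j ∈ X ∧ ∀ l, i < l → l < j → c l ∉ X := by
  obtain ⟨t, rfl⟩ := (h.verts v).1 hv
  obtain ⟨x, hx, y, hy, hxy⟩ := (one_lt_ncard (finite_of_ncard_pos (by omega))).1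
    (show 1 < X.ncard by omega)
  obtain ⟨l1, e1, e2, hl1⟩ := h.window t (hXK hx)
  have e3 : l1 ≠ t := by
    rintro rfl
    exact hvX (hl1 ▸ hx)
  obtain ⟨i, j, f1, f2, f3, f4, f5, f6⟩ := exists_adjacent_AB (fun l => c l ∈ X ∧ l < t + n)
    (fun l => c l ∈ X ∧ t + n < l) _ l1 (l1 + n) rfl (by omega) ⟨hl1 ▸ hx, by omega⟩
    ⟨by rw [h.per]; exact hl1 ▸ hx, by omega⟩
  have hno : ∀ l, i < l → l < j → c l ∉ X := by
    intro l h1 h2 hl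
    have h3 := f6 l h1 h2
    rcases lt_trichotomy l (t + n) with h4 | h4 | h4
    · exact h3.1 ⟨hl, h4⟩
    · subst h4
      rw [h.per] at hl
      exact hvX hl
    · exact h3.2 ⟨hl, h4⟩
  have f4' := f4.2
  have f5' := f5.2
  refine ⟨i, j, by omega, ?_, f4.1, f5.1, hno⟩
  by_contra hj
  obtain ⟨l, g1, g2, hl⟩ := h.window l1 (hXK hy)
  have : l ≠ l1 := by
    rintro rfl
    exact hxy (hl1.symm.trans hl)
  exact hno l (by omega) (by omega) (hl ▸ hy)

lemma CycParam.next_eq {H : G.Subgraph} {n : ℕ} {c : ℕ → V} (h : CycParam H n c) {X : Set V}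
    {α β α' β' : ℕ} (h1 : α < β) (h1' : α' < β') (hX : c β ∈ X) (hX' : c β' ∈ X)
    (hno : ∀ l, α < l → l < β → c l ∉ X) (hno' : ∀ l, α' < l → l < β' → c l ∉ X)
    (heq : c α = c α') : c β = c β' := by
  have e1 := h.shift heq (β - α)
  have e2 := h.shift heq (β' - α')
  rw [show α + (β - α) = β by omega] at e1
  rw [show α' + (β' - α') = β' by omega] at e2
  rcases lt_trichotomy (β - α) (β' - α') with hl | hl | hl
  · exact (hno' _ (by omega) (by omega) (e1 ▸ hX)).elim
  · rw [e1]; congr 1; omega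
  · exact (hno _ (by omega) (by omega) (e2 ▸ hX')).elim

/-- Two nested cycles with the same vertex set `X` are equal. -/
lemma eq_of_verts_eq {γ : Drawing G} {H K : G.Subgraph} (hH : IsCycleSubgraph H)
    (hK : IsCycleSubgraph K) (hHcf : γ.CrossingFree H) (hKcf : γ.CrossingFree K) {X : Set V}
    (hHX : H.verts = X) (hKX : K.verts = X) (hnest : γ.image K ⊆ closedRegion (γ.image H)) :
    K = H := by
  obtain ⟨n, c, hc⟩ := exists_cycParam hH
  obtain ⟨n', c', hc'⟩ := exists_cycParam hK
  have hX : H.verts ∩ K.verts = X := by rw [hHX, hKX, inter_self]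
  have h3 := hc.three
  have h3' := hc'.three
  have hle : ∀ u v, K.Adj u v → H.Adj u v := by
    intro u v huv
    obtain ⟨l, hl⟩ := (hc'.adj _ _).1 huv
    obtain ⟨α, β, h1, h2, h4, h5⟩ := consecutive hc hc' hHcf hKcf hX hnest (p := l) (q := l + 1)
      (by omega) (by omega) (hKX ▸ hc'.mem _) (hKX ▸ hc'.mem _) (fun t _ _ => by omega)
    have h6 : β = α + 1 := by
      by_contra hne
      exact h5 (α + 1) (by omega) (by omega) (hHX ▸ hc.mem _)
    rw [hc.adj]
    exact ⟨α, by rw [hl, h4, h6]⟩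
  have hv : K.verts = H.verts := hKX.trans hHX.symm
  refine SimpleGraph.Subgraph.ext hv ?_
  ext u v
  refine ⟨hle u v, fun huv => ?_⟩
  have hu := H.edge_vert huv
  have hsub : K.neighborSet u ⊆ H.neighborSet u := fun w hw => hle u w hw
  have hfin : (H.neighborSet u).Finite := finite_of_ncard_pos (by rw [hH.2.2 u hu]; norm_num)
  have := eq_of_subset_of_ncard_le hsub (by rw [hH.2.2 u hu, hK.2.2 u (hv ▸ hu)]) hfin
  have h7 : v ∈ K.neighborSet u := this ▸ huv
  exact h7

/-- **from the proof of Theorem 2.** Let `k ≥ 1`, let `γ` be a drawing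
of a graph `G`, and let `D₁, …, D_m` be pairwise distinct crossing-free nested cycles
of `G` such that there is a set `X ⊆ V(G)` with `2 ≤ |X| ≤ 12k − 1` and
`V(Dᵢ) ∩ V(Dⱼ) = X` for all distinct `i, j`. If `m ≥ 24k²`, then `γ` has a `2`-nest of
size `k`. -/
theorem statement9 {V : Type} {G : SimpleGraph V} (k : ℕ) (hk : 1 ≤ k)
    (γ : Drawing G) (m : ℕ) (hm : 24 * k ^ 2 ≤ m)
    (D : Fin m → G.Subgraph)
    (hcyc : ∀ i, IsCycleSubgraph (D i))
    (hdistinct : ∀ i j, i ≠ j → D i ≠ D j)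
    (hcf : ∀ i, γ.CrossingFree (D i))
    (hnested : ∀ i : ℕ, ∀ h : i + 1 < m,
      γ.image (D ⟨i + 1, h⟩) ⊆ closedRegion (γ.image (D ⟨i, by omega⟩)))
    (X : Set V) (hXfin : X.Finite) (hX2 : 2 ≤ X.ncard) (hX12 : X.ncard ≤ 12 * k - 1)
    (hXij : ∀ i j, i ≠ j → (D i).verts ∩ (D j).verts = X) :
    ∃ C : Fin k → G.Subgraph, γ.IsSNest 2 C := by
  classical
  have hk2 : 1 ≤ k ^ 2 := Nat.one_le_pow _ _ hk
  have hm0 : 24 ≤ m := by omega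
  have hXD : ∀ i, X ⊆ (D i).verts := by
    intro i
    obtain ⟨j, hj⟩ : ∃ j : Fin m, i ≠ j := by
      by_cases h : i.1 = 0
      · exact ⟨⟨1, by omega⟩, fun h' => by rw [h'] at h; simp at h⟩
      · exact ⟨⟨0, by omega⟩, fun h' => h (by rw [h'])⟩
    rw [← hXij i j hj]
    exact inter_subset_left
  have hchain : ∀ i j : ℕ, i ≤ j → ∀ (hj : j < m) (hi : i < m),
      γ.image (D ⟨j, hj⟩) ⊆ closedRegion (γ.image (D ⟨i, hi⟩)) := by
    intro i j hij
    induction j, hij using Nat.le_induction with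
    | base => intro hj hi; exact subset_closedRegion _
    | succ j hij ih =>
      intro hj hi
      exact (hnested j hj).trans (closedRegion_mono (ih (by omega) hi))
  have hone : ∀ i j : Fin m, i < j → (D i).verts = X → (D j).verts = X → False := by
    intro i j hij h1 h2
    have := eq_of_verts_eq (hcyc i) (hcyc j) (hcf i) (hcf j) h1 h2
      (hchain i.1 j.1 (le_of_lt hij) j.2 i.2)
    exact hdistinct j i (ne_of_gt hij) this
  let z : Fin m := ⟨0, by omega⟩
  let T : Finset (Fin m) := Finset.univ.filter (fun i => i ≠ z ∧ (D i).verts ≠ X)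
  have hT : m ≤ T.card + 2 := by
    have h1 : (Finset.univ.filter (fun i : Fin m => (D i).verts = X)).card ≤ 1 := by
      rw [Finset.card_le_one]
      intro i hi j hj
      simp only [Finset.mem_filter, Finset.mem_univ, true_and] at hi hj
      rcases lt_trichotomy i j with h | h | h
      · exact (hone i j h hi hj).elim
      · exact h
      · exact (hone j i h hj hi).elim
    have h2 : (Finset.univ : Finset (Fin m)) ⊆
        T ∪ ({z} ∪ Finset.univ.filter (fun i : Fin m => (D i).verts = X)) := by
      intro i _
      simp only [T, Finset.mem_union, Finset.mem_filter, Finset.mem_univ, true_and,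
        Finset.mem_singleton]
      tauto
    have h3 := Finset.card_le_card h2
    have h4 := Finset.card_union_le T
      ({z} ∪ Finset.univ.filter (fun i : Fin m => (D i).verts = X))
    have h5 := Finset.card_union_le {z} (Finset.univ.filter (fun i : Fin m => (D i).verts = X))
    rw [Finset.card_univ, Fintype.card_fin] at h3
    rw [Finset.card_singleton] at h5
    omega
  obtain ⟨n, c, hc⟩ := exists_cycParam (hcyc z)
  have key : ∀ i : Fin m, ∃ α β : ℕ, i ∈ T → α < β ∧ c α ∈ X ∧ c β ∈ X ∧
      (∀ l, α < l → l < β → c l ∉ X) ∧ ∃ w : G.Walk (c α) (c β), GoodPath γ (D i) X w := by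
    intro i
    by_cases hi : i ∈ T
    swap
    · exact ⟨0, 0, fun h => (hi h).elim⟩
    have hi' := hi
    simp only [T, Finset.mem_filter, Finset.mem_univ, true_and] at hi'
    obtain ⟨n', c', hc'⟩ := exists_cycParam (hcyc i)
    obtain ⟨v, hv, hvX⟩ : ∃ v ∈ (D i).verts, v ∉ X := by
      by_contra! hcon
      exact hi'.2 (Subset.antisymm hcon (hXD i))
    obtain ⟨p, q, hpq, hq, hpX, hqX, hno⟩ := hc'.exists_segment (hXD i) hX2 hv hvX
    obtain ⟨w, hw⟩ := hc'.goodPath (hcf i) hpq hq hno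
    obtain ⟨α, β, h1, h2, h3, h4⟩ := consecutive hc hc' (hcf z) (hcf i)
      (hXij z i (Ne.symm hi'.1)) (hchain 0 i.1 (Nat.zero_le _) i.2 z.2)
      (show p < q by omega) hq hpX hqX hno
    refine ⟨α, β, fun _ => ⟨h1, ?_⟩⟩
    rcases Sym2.eq_iff.1 h3 with ⟨e1, e2⟩ | ⟨e1, e2⟩
    · rw [e1] at hpX
      rw [e2] at hqX
      refine ⟨hpX, hqX, h4, ?_⟩
      rw [← e1, ← e2]
      exact ⟨w, hw⟩
    · rw [e1] at hpX
      rw [e2] at hqX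
      refine ⟨hqX, hpX, h4, ?_⟩
      rw [← e1, ← e2]
      exact ⟨w.reverse, hw.reverse⟩
  choose α β hab using key
  obtain ⟨a, haX, hfib⟩ := Finset.exists_lt_card_fiber_of_mul_lt_card_of_maps_to
    (s := T) (t := hXfin.toFinset) (f := fun i => c (α i)) (n := 2 * k - 1)
    (fun i hi => by simpa using (hab i hi).2.1) (by
      rw [← Set.ncard_eq_toFinset_card X hXfin]
      obtain ⟨k', rfl⟩ : ∃ k', k = k' + 1 := ⟨k - 1, by omega⟩
      have e1 : 2 * (k' + 1) - 1 = 2 * k' + 1 := by omega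
      have e2 : 12 * (k' + 1) - 1 = 12 * k' + 11 := by omega
      rw [e2] at hX12
      rw [e1]
      have := Nat.mul_le_mul_right (2 * k' + 1) hX12
      nlinarith)
  set F := T.filter (fun i => c (α i) = a) with hF
  have hFT : ∀ i ∈ F, i ∈ T ∧ c (α i) = a := fun i hi => by simpa [hF] using hi
  obtain ⟨i0, hi0⟩ : F.Nonempty := Finset.card_pos.1 (by omega)
  obtain ⟨b, hb⟩ : ∃ b, b = c (β i0) := ⟨_, rfl⟩
  have hw : ∀ i, ∃ w : G.Walk a b, i ∈ F → GoodPath γ (D i) X w := by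
    have h0 : ∀ i ∈ F, ∃ w : G.Walk a b, GoodPath γ (D i) X w := by
      intro i hi
      obtain ⟨hiT, hia⟩ := hFT i hi
      obtain ⟨hT0, h0a⟩ := hFT i0 hi0
      obtain ⟨h1, -, h3, h4, h5⟩ := hab i hiT
      obtain ⟨h1', -, h3', h4', -⟩ := hab i0 hT0
      have := hc.next_eq h1 h1' h3 h3' h4 h4' (hia.trans h0a.symm)
      rw [hia, this, ← hb] at h5
      exact h5
    intro i
    by_cases hi : i ∈ F
    · obtain ⟨w, hw⟩ := h0 i hi
      exact ⟨w, fun _ => hw⟩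
    · obtain ⟨w, hw⟩ := h0 i0 hi0
      exact ⟨w, fun h => (hi h).elim⟩
  choose w hw using hw
  have hne : a ≠ b := by
    rintro rfl
    exact (hw i0 hi0).arc.ne rfl
  have : Nonempty (Fin m) := ⟨z⟩
  refine nest_of_paths γ k F hne w (by omega) (fun i hi => (hw i hi).path) ?_
    (fun i hi => (hw i hi).arc) (fun i hi => (hw i hi).ends) ?_
  · intro i hi e he
    exact hcf i e ((hw i hi).edges e ((SimpleGraph.Walk.mem_edges_toSubgraph _).1 he))
  · intro i hi j hj hij v hv hv'
    refine (hw i hi).avoid v hv ?_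
    rw [← hXij i j hij]
    exact ⟨(hw i hi).sup v hv, (hw j hj).sup v hv'⟩

end CrossingPaper
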